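/- For every λ-convex body K ⊆ ℝ², the area satisfies |K| ≥ |∂K|/(2λ) − (1/λ²) sin(λ|∂K|/2), with equality if and only if K is a λ-convex lens. -/

import Mathlib

open scoped MeasureTheory
open MeasureTheory Real

/-- A convex body `K ⊆ ℝⁿ` is `λ`-convex (in the barrier sense) if at every boundary
point `p` there is a locally supporting ball of radius `1/λ` through `p`. -/
def IsLambdaConvex {n : ℕ} (lam : ℝ) (K : Set (EuclideanSpace ℝ (Fin n))) : Prop :=
  ∀ p ∈ frontier K, ∃ U ∈ nhds p, ∃ z : EuclideanSpace ℝ (Fin n),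
    dist p z = 1 / lam ∧ U ∩ frontier K ⊆ Metric.closedBall z (1 / lam)

/-- A `λ`-convex lens: the intersection of two closed balls of radius `1/λ` whose
centers are at distance less than `2/λ`. -/
def IsLens {n : ℕ} (lam : ℝ) (L : Set (EuclideanSpace ℝ (Fin n))) : Prop :=
  ∃ c₁ c₂ : EuclideanSpace ℝ (Fin n), dist c₁ c₂ < 2 / lam ∧
    L = Metric.closedBall c₁ (1 / lam) ∩ Metric.closedBall c₂ (1 / lam)

section

open Set Function

local notation "Plane" => EuclideanSpace ℝ (Fin 2)

theorem integral_eq_sub_of_lipschitz {f f' : ℝ → ℝ} {C : NNReal} (hf : LipschitzWith C f)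
    (h : ∀ᵐ t, HasDerivAt f (f' t) t) (a b : ℝ) : ∫ t in a..b, f' t = f b - f a := by
  rw [← ((hf.lipschitzOnWith (s := uIcc a b)).absolutelyContinuousOnInterval).integral_deriv_eq_sub]
  refine intervalIntegral.integral_congr_ae ?_
  filter_upwards [h] with t ht _ using ht.deriv.symm

section Triangle

variable {F : ℝ → ℝ → ℝ} {a b : ℝ}

theorem setIntegral_triangle_left (F : ℝ → ℝ → ℝ) {a b x : ℝ} (hx : x ∈ Ioc a b) :
    ∫ y in Ioc a b, {p : ℝ × ℝ | p.2 ≤ p.1}.indicator (uncurry F) (x, y)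
      = ∫ y in a..x, F x y := by
  have : (fun y => {p : ℝ × ℝ | p.2 ≤ p.1}.indicator (uncurry F) (x, y))
      = (Iic x).indicator (F x) := by
    ext y
    by_cases h : y ≤ x <;> simp [indicator, h]
  rw [this, setIntegral_indicator measurableSet_Iic, intervalIntegral.integral_of_le hx.1.le,
    Ioc_inter_Iic, min_eq_right hx.2]

theorem setIntegral_triangle_right (F : ℝ → ℝ → ℝ) {a b y : ℝ} (hy : y ∈ Ioc a b) :
    ∫ x in Ioc a b, {p : ℝ × ℝ | p.2 ≤ p.1}.indicator (uncurry F) (x, y)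
      = ∫ x in y..b, F x y := by
  have : (fun x => {p : ℝ × ℝ | p.2 ≤ p.1}.indicator (uncurry F) (x, y))
      = (Ici y).indicator (fun x => F x y) := by
    ext x
    by_cases h : y ≤ x <;> simp [indicator, h]
  rw [this, setIntegral_indicator measurableSet_Ici, intervalIntegral.integral_of_le hy.2,
    ← integral_Icc_eq_integral_Ioc]
  congr 2
  ext x
  simp only [mem_inter_iff, mem_Ioc, mem_Ici, mem_Icc]
  exact ⟨fun h => ⟨h.2, h.1.2⟩, fun h => ⟨⟨hy.1.trans_le h.1, h.2⟩, h.1⟩⟩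

theorem integrable_triangle (hF : IntegrableOn (uncurry F) (Ioc a b ×ˢ Ioc a b)) :
    Integrable ({p : ℝ × ℝ | p.2 ≤ p.1}.indicator (uncurry F))
      ((volume.restrict (Ioc a b)).prod (volume.restrict (Ioc a b))) := by
  rw [Measure.prod_restrict]
  exact Integrable.indicator hF (measurableSet_le measurable_snd measurable_fst)

theorem intervalIntegrable_triangle (hab : a ≤ b)
    (hF : IntegrableOn (uncurry F) (Ioc a b ×ˢ Ioc a b)) :
    IntervalIntegrable (fun x => ∫ y in a..x, F x y) volume a b := by
  rw [intervalIntegrable_iff_integrableOn_Ioc_of_le hab]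
  refine (integrable_triangle hF).integral_prod_left.congr ?_
  filter_upwards [ae_restrict_mem measurableSet_Ioc] with x hx
  exact setIntegral_triangle_left F hx

theorem integral_triangle_swap (hab : a ≤ b)
    (hF : IntegrableOn (uncurry F) (Ioc a b ×ˢ Ioc a b)) :
    ∫ x in a..b, ∫ y in a..x, F x y = ∫ y in a..b, ∫ x in y..b, F x y := by
  rw [intervalIntegral.integral_of_le hab, intervalIntegral.integral_of_le hab,
    ← setIntegral_congr_fun measurableSet_Ioc (fun x hx => setIntegral_triangle_left F hx),
    ← setIntegral_congr_fun measurableSet_Ioc (fun y hy => setIntegral_triangle_right F hy)]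
  exact integral_integral_swap (integrable_triangle hF)

end Triangle

/-- `s` is an antiderivative of a measurable density `ρ` with values in `[0, 1]`. -/
structure IsArcLength (ρ s : ℝ → ℝ) : Prop where
  measurable : Measurable ρ
  nonneg : ∀ t, 0 ≤ ρ t
  le_one : ∀ t, ρ t ≤ 1
  lipschitz : LipschitzWith 1 s
  hasDerivAt : ∀ᵐ t, HasDerivAt s (ρ t) t

/-- The defect in the concavity inequality for `sin` between `u` and `u + D`. -/
noncomputable def sinDefect (D u δ : ℝ) : ℝ :=
  sin (u + δ) - sin u - δ / D * (sin (u + D) - sin u)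

theorem sinDefect_nonneg {D u δ : ℝ} (hu : 0 ≤ u) (hδ : 0 ≤ δ) (hδD : δ ≤ D) (hD : u + D ≤ π) :
    0 ≤ sinDefect D u δ := by
  unfold sinDefect
  rcases hδ.trans hδD |>.eq_or_lt with h | h
  · have : δ = 0 := by linarith
    subst this; simp
  have := strictConcaveOn_sin_Icc.concaveOn.2 (show u ∈ Icc 0 π from ⟨hu, by linarith⟩)
    (show u + D ∈ Icc 0 π from ⟨by linarith, hD⟩) 
    (show 0 ≤ 1 - δ / D by rw [sub_nonneg, div_le_one h]; exact hδD)
    (show 0 ≤ δ / D by positivity) (by ring)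
  simp only [smul_eq_mul] at this
  have e : (1 - δ / D) * u + δ / D * (u + D) = u + δ := by field_simp; ring
  rw [e] at this
  linarith

theorem sinDefect_pos {D u δ : ℝ} (hu : 0 ≤ u) (hδ : 0 < δ) (hδD : δ < D) (hD : u + D ≤ π) :
    0 < sinDefect D u δ := by
  unfold sinDefect
  have h := hδ.trans hδD
  have := strictConcaveOn_sin_Icc.2 (show u ∈ Icc 0 π from ⟨hu, by linarith⟩)
    (show u + D ∈ Icc 0 π from ⟨by linarith, hD⟩) (by linarith) 
    (show 0 < 1 - δ / D by rw [sub_pos, div_lt_one h]; exact hδD)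
    (show 0 < δ / D by positivity) (by ring)
  simp only [smul_eq_mul] at this
  have e : (1 - δ / D) * u + δ / D * (u + D) = u + δ := by field_simp; ring
  rw [e] at this
  linarith

namespace IsArcLength

variable {ρ s : ℝ → ℝ} (h : IsArcLength ρ s)
include h

theorem continuous : Continuous s := h.lipschitz.continuous

theorem abs_le_one (t : ℝ) : |ρ t| ≤ 1 := by
  rw [abs_of_nonneg (h.nonneg t)]; exact h.le_one t

theorem intervalIntegrable_mul {k : ℝ → ℝ} (hk : Continuous k) (a b : ℝ) :
    IntervalIntegrable (fun t => ρ t * k t) volume a b := by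
  rw [intervalIntegrable_iff]
  refine (intervalIntegrable_iff.mp (hk.intervalIntegrable a b)).bdd_mul (c := 1)
    h.measurable.aestronglyMeasurable ?_
  filter_upwards with t
  simpa using h.abs_le_one t

theorem intervalIntegrable (a b : ℝ) : IntervalIntegrable ρ volume a b := by
  simpa using h.intervalIntegrable_mul (continuous_const (y := (1 : ℝ))) a b

theorem integral_eq (a b : ℝ) : ∫ t in a..b, ρ t = s b - s a :=
  integral_eq_sub_of_lipschitz h.lipschitz h.hasDerivAt a b

theorem monotone : Monotone s := by
  intro a b hab
  have := intervalIntegral.integral_nonneg_of_forall (μ := volume) hab h.nonneg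
  rw [h.integral_eq] at this
  linarith

theorem sub_le {a b : ℝ} (hab : a ≤ b) : s b - s a ≤ b - a := by
  have := h.lipschitz.dist_le_mul b a
  rw [Real.dist_eq, Real.dist_eq, abs_of_nonneg (sub_nonneg.2 hab)] at this
  have := le_abs_self (s b - s a)
  simp at *; linarith

theorem integrableOn_square {k : ℝ × ℝ → ℝ} (hk : Continuous k) (a b : ℝ) :
    IntegrableOn (fun p : ℝ × ℝ => ρ p.1 * (ρ p.2 * k p)) (Ioc a b ×ˢ Ioc a b) := by
  have h0 : IntegrableOn k (Ioc a b ×ˢ Ioc a b) :=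
    (hk.continuousOn.integrableOn_compact (isCompact_Icc.prod isCompact_Icc)).mono_set
      (prod_mono Ioc_subset_Icc_self Ioc_subset_Icc_self)
  refine Integrable.bdd_mul (c := 1) (Integrable.bdd_mul (c := 1) h0 ?_ ?_) ?_ ?_
  · exact (h.measurable.comp measurable_snd).aestronglyMeasurable
  · filter_upwards with t
    simpa using h.abs_le_one t.2
  · exact (h.measurable.comp measurable_fst).aestronglyMeasurable
  · filter_upwards with t
    simpa using h.abs_le_one t.1

/-- Change of variables along `s`. -/
theorem integral_comp {g G : ℝ → ℝ} (hG : LipschitzWith 1 G) (hg : ∀ x, HasDerivAt G (g x) x)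
    (a b : ℝ) : ∫ t in a..b, ρ t * g (s t) = G (s b) - G (s a) := by
  refine integral_eq_sub_of_lipschitz (f := fun t => G (s t)) (hG.comp h.lipschitz) ?_ a b
  filter_upwards [h.hasDerivAt] with t ht
  have := (hg (s t)).comp t ht
  rw [mul_comm] at this
  exact this

theorem integral_sin_sub (c a b : ℝ) :
    ∫ t in a..b, ρ t * sin (c - s t) = cos (c - s b) - cos (c - s a) := by
  refine h.integral_comp (g := fun x => sin (c - x)) (G := fun x => cos (c - x)) ?_ ?_ a b
  · have : LipschitzWith 1 (fun x : ℝ => c - x) :=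
      LipschitzWith.of_dist_le_mul (by intro x y; rw [dist_sub_left]; simp)
    simpa [Function.comp_def] using lipschitzWith_cos.comp this
  · intro x
    have := ((hasDerivAt_id x).const_sub c).cos
    simpa using this

theorem integral_sin_sub' (c a b : ℝ) :
    ∫ t in a..b, ρ t * sin (s t - c) = cos (s a - c) - cos (s b - c) := by
  have := h.integral_sin_sub c a b
  rw [← neg_inj, ← intervalIntegral.integral_neg] at this
  rw [← cos_neg (s a - c), ← cos_neg (s b - c), neg_sub, neg_sub, ← neg_sub (cos _), ← this]
  congr 1; ext t; rw [← neg_sub c, sin_neg]; ring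

theorem integral_one_sub_cos (a b : ℝ) :
    ∫ t in a..b, ρ t * (1 - cos (s t - s a)) = (s b - s a) - sin (s b - s a) := by
  have := integral_eq_sub_of_lipschitz (f := fun t => s t - sin (s t - s a))
    (f' := fun t => ρ t * (1 - cos (s t - s a))) (C := 1 + 1) ?_ ?_ a b
  · rw [this]; simp; ring
  · refine h.lipschitz.sub ?_
    have : LipschitzWith 1 (fun t : ℝ => s t - s a) :=
      LipschitzWith.of_dist_le_mul (by
        intro x y; rw [dist_sub_right]; exact h.lipschitz.dist_le_mul x y)
    simpa [Function.comp_def] using lipschitzWith_sin.comp this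
  · filter_upwards [h.hasDerivAt] with t ht
    have := ht.sub ((ht.sub_const (s a)).sin)
    exact this.congr_deriv (by ring)

/-- The twice-area of a half of the body, between its chord and its boundary arc. -/
theorem half_integral_eq {a D : ℝ} (hD : s (a + π) - s a = π - D) :
    ∫ x in a..(a + π), ρ x * ∫ y in a..x, ρ y * sin (x - y)
      = (s (a + π) - s a) - sin (s (a + π) - s a)
        + ∫ x in a..(a + π), ∫ y in a..x,
            ρ x * (ρ y * sinDefect D (s x - s y) ((x - y) - (s x - s y))) := by
  have hab : a ≤ a + π := by linarith [pi_pos]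
  set b := a + π with hb
  have hsc := h.continuous
  let g : ℝ → ℝ := fun u => sin (u + D) - sin u
  have hg : Continuous g := by fun_prop
  have I (k : ℝ × ℝ → ℝ) (hk : Continuous k) :
      IntervalIntegrable (fun x => ∫ y in a..x, ρ x * (ρ y * k (x, y))) volume a b :=
    intervalIntegrable_triangle (F := fun x y => ρ x * (ρ y * k (x, y))) hab
      (h.integrableOn_square hk a b)
  have J (k : ℝ → ℝ) (hk : Continuous k) (c d x : ℝ) :
      IntervalIntegrable (fun y => ρ x * (ρ y * k y)) volume c d :=
    (h.intervalIntegrable_mul hk c d).const_mul _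
  have A1 : ∫ x in a..b, ∫ y in a..x, ρ x * (ρ y * sin (s x - s y))
      = (s b - s a) - sin (s b - s a) := by
    rw [← h.integral_one_sub_cos]
    congr 1; ext x
    rw [intervalIntegral.integral_const_mul, h.integral_sin_sub]
    simp
  have A2 : ∫ x in a..b, ∫ y in a..x, ρ x * (ρ y * ((x - s x) * g (s x - s y)))
      = ∫ x in a..b, ρ x * ((x - s x) *
          (cos D - cos (s x - s a + D) - 1 + cos (s x - s a))) := by
    congr 1; ext x
    rw [intervalIntegral.integral_const_mul]
    congr 1
    have : ∀ y, ρ y * ((x - s x) * g (s x - s y))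
        = (x - s x) * (ρ y * sin (s x + D - s y) - ρ y * sin (s x - s y)) := by
      intro y
      simp only [g]
      rw [show s x - s y + D = s x + D - s y by ring]; ring
    simp_rw [this]
    rw [intervalIntegral.integral_const_mul, intervalIntegral.integral_sub, h.integral_sin_sub,
      h.integral_sin_sub]
    · simp only [add_sub_cancel_left, sub_self, cos_zero]
      rw [show s x - s a + D = s x + D - s a by ring]; ring
    · exact h.intervalIntegrable_mul (by fun_prop) _ _
    · exact h.intervalIntegrable_mul (by fun_prop) _ _
  have A3 : ∫ x in a..b, ∫ y in a..x, ρ x * (ρ y * ((y - s y) * g (s x - s y)))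
      = ∫ x in a..b, ρ x * ((x - s x) *
          (cos D - cos (s x - s a + D) - 1 + cos (s x - s a))) := by
    rw [integral_triangle_swap (F := fun x y => ρ x * (ρ y * ((y - s y) * g (s x - s y)))) hab
      (h.integrableOn_square (k := fun p => (p.2 - s p.2) * g (s p.1 - s p.2)) (by fun_prop) a b)]
    congr 1; ext y
    have : ∀ x, ρ x * (ρ y * ((y - s y) * g (s x - s y)))
        = (ρ y * (y - s y)) * (ρ x * sin (s x - (s y - D)) - ρ x * sin (s x - s y)) := by
      intro x
      simp only [g]
      rw [show s x - s y + D = s x - (s y - D) by ring]; ring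
    simp_rw [this]
    rw [intervalIntegral.integral_const_mul, intervalIntegral.integral_sub, h.integral_sin_sub',
      h.integral_sin_sub']
    · rw [show s y - (s y - D) = D by ring, show s b - (s y - D) = π - (s y - s a) by linarith,
        show s b - s y = π - (s y - s a + D) by linarith, cos_pi_sub, cos_pi_sub]
      simp only [sub_self, cos_zero]
      ring
    · exact h.intervalIntegrable_mul (by fun_prop) _ _
    · exact h.intervalIntegrable_mul (by fun_prop) _ _
  have split : ∀ x, ρ x * ∫ y in a..x, ρ y * sin (x - y)
      = (∫ y in a..x, ρ x * (ρ y * sin (s x - s y)))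
        + D⁻¹ * ((∫ y in a..x, ρ x * (ρ y * ((x - s x) * g (s x - s y))))
          - ∫ y in a..x, ρ x * (ρ y * ((y - s y) * g (s x - s y))))
        + ∫ y in a..x, ρ x * (ρ y * sinDefect D (s x - s y) ((x - y) - (s x - s y))) := by
    intro x
    rw [← intervalIntegral.integral_sub, ← intervalIntegral.integral_const_mul,
      ← intervalIntegral.integral_const_mul, ← intervalIntegral.integral_add,
      ← intervalIntegral.integral_add]
    · congr 1; ext y
      simp only [sinDefect, g]
      rw [show s x - s y + (x - y - (s x - s y)) = x - y by ring]
      ring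
    · refine IntervalIntegrable.add (J _ (by fun_prop) _ _ _) ?_
      exact IntervalIntegrable.const_mul
        ((J _ (by fun_prop) _ _ _).sub (J _ (by fun_prop) _ _ _)) _
    · exact J _ (by unfold sinDefect; fun_prop) _ _ _
    · exact J _ (by fun_prop) _ _ _
    · exact IntervalIntegrable.const_mul
        ((J _ (by fun_prop) _ _ _).sub (J _ (by fun_prop) _ _ _)) _
    · exact J _ (by fun_prop) _ _ _
    · exact J _ (by fun_prop) _ _ _
  have I1 := I (fun p => sin (s p.1 - s p.2)) (by fun_prop)
  have I2 := I (fun p => (p.1 - s p.1) * g (s p.1 - s p.2)) (by fun_prop)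
  have I3 := I (fun p => (p.2 - s p.2) * g (s p.1 - s p.2)) (by fun_prop)
  have I4 := I (fun p => sinDefect D (s p.1 - s p.2) ((p.1 - p.2) - (s p.1 - s p.2)))
    (by unfold sinDefect; fun_prop)
  simp_rw [split]
  rw [intervalIntegral.integral_add (I1.add ((I2.sub I3).const_mul _)) I4,
    intervalIntegral.integral_add I1 ((I2.sub I3).const_mul _),
    intervalIntegral.integral_const_mul, intervalIntegral.integral_sub I2 I3, A1, A2, A3]
  ring

theorem sinDefect_arc_nonneg {a D x y : ℝ} (hD : s (a + π) - s a = π - D) (hy : a ≤ y)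
    (hyx : y ≤ x) (hx : x ≤ a + π) :
    0 ≤ sinDefect D (s x - s y) ((x - y) - (s x - s y)) := by
  have h1 := h.monotone hyx
  have h2 := h.sub_le hyx
  have h3 := h.sub_le hy
  have h4 := h.sub_le hx
  have h5 := h.monotone hy
  have h6 := h.monotone hx
  exact sinDefect_nonneg (by linarith) (by linarith) (by linarith) (by linarith)

theorem half_integral_ge (a : ℝ) :
    (s (a + π) - s a) - sin (s (a + π) - s a)
      ≤ ∫ x in a..(a + π), ρ x * ∫ y in a..x, ρ y * sin (x - y) := by
  have hD : s (a + π) - s a = π - (π - (s (a + π) - s a)) := by ring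
  rw [h.half_integral_eq hD, le_add_iff_nonneg_right]
  refine intervalIntegral.integral_nonneg (by linarith [pi_pos]) fun x hx => ?_
  refine intervalIntegral.integral_nonneg hx.1 fun y hy => ?_
  exact mul_nonneg (h.nonneg x) (mul_nonneg (h.nonneg y)
    (h.sinDefect_arc_nonneg hD hy.1 hy.2 hx.2))

/-- In the equality case, the excess turning between two points of positive curvature radius is
either zero or maximal. -/
theorem ae_dichotomy_of_half_integral_eq {a D : ℝ} (hD : s (a + π) - s a = π - D)
    (heq : ∫ x in a..(a + π), ρ x * ∫ y in a..x, ρ y * sin (x - y)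
      = (s (a + π) - s a) - sin (s (a + π) - s a)) :
    ∀ᵐ x, x ∈ Ioc a (a + π) → ρ x ≠ 0 → ∀ᵐ y, y ∈ Ioc a x → ρ y ≠ 0 →
      (x - s x) - (y - s y) = 0 ∨ (x - s x) - (y - s y) = D := by
  have hab : a ≤ a + π := by linarith [pi_pos]
  have hsc := h.continuous
  have hcont : Continuous fun p : ℝ × ℝ =>
      sinDefect D (s p.1 - s p.2) ((p.1 - p.2) - (s p.1 - s p.2)) := by
    unfold sinDefect; fun_prop
  rw [h.half_integral_eq hD, add_eq_left, intervalIntegral.integral_eq_zero_iff_of_nonneg_ae] at heq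
  rotate_left
  · rw [Ioc_eq_empty (not_lt.2 hab), union_empty]
    filter_upwards [ae_restrict_mem measurableSet_Ioc] with x hx
    refine intervalIntegral.integral_nonneg hx.1.le fun y hy => ?_
    exact mul_nonneg (h.nonneg x) (mul_nonneg (h.nonneg y)
      (h.sinDefect_arc_nonneg hD hy.1 hy.2 hx.2))
  · exact intervalIntegrable_triangle
      (F := fun x y => ρ x * (ρ y * sinDefect D (s x - s y) ((x - y) - (s x - s y)))) hab
      (h.integrableOn_square hcont a (a + π))
  rw [Ioc_eq_empty (not_lt.2 hab), union_empty, Filter.EventuallyEq,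
    ae_restrict_iff' measurableSet_Ioc] at heq
  filter_upwards [heq] with x hx hxa hρx
  have := hx hxa
  simp only [Pi.zero_apply] at this
  rw [intervalIntegral.integral_eq_zero_iff_of_nonneg_ae] at this
  rotate_left
  · rw [Ioc_eq_empty (not_lt.2 hxa.1.le), union_empty]
    filter_upwards [ae_restrict_mem measurableSet_Ioc] with y hy
    exact mul_nonneg (h.nonneg x) (mul_nonneg (h.nonneg y)
      (h.sinDefect_arc_nonneg hD hy.1.le hy.2 hxa.2))
  · have hk : Continuous fun y => sinDefect D (s x - s y) ((x - y) - (s x - s y)) := by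
      unfold sinDefect; fun_prop
    exact (h.intervalIntegrable_mul hk a x).const_mul _
  rw [Ioc_eq_empty (not_lt.2 hxa.1.le), union_empty, Filter.EventuallyEq,
    ae_restrict_iff' measurableSet_Ioc] at this
  filter_upwards [this] with y hy hya hρy
  have h0 := hy hya
  simp only [Pi.zero_apply, mul_eq_zero, hρx, hρy, false_or] at h0
  by_contra hne
  push Not at hne
  have h1 := h.monotone hya.2
  have h2 := h.sub_le hya.2
  have h3 := h.sub_le hya.1.le
  have h4 := h.sub_le hxa.2
  have h5 := h.monotone hya.1.le
  have h6 := h.monotone hxa.2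
  refine (sinDefect_pos (D := D) (u := s x - s y) (δ := (x - y) - (s x - s y)) (by linarith)
    (lt_of_le_of_ne (by linarith) fun hh => hne.1 (by linarith))
    (lt_of_le_of_ne (by linarith) fun hh => hne.2 (by linarith)) (by linarith)).ne' h0

end IsArcLength

theorem plane_dist_sq (x y : Plane) : dist x y ^ 2 = (x 0 - y 0) ^ 2 + (x 1 - y 1) ^ 2 := by
  rw [EuclideanSpace.dist_eq, sq_sqrt (by positivity)]
  simp [Fin.sum_univ_two, Real.dist_eq, sq_abs]

theorem plane_dist_le_iff {x y : Plane} {r : ℝ} (hr : 0 ≤ r) :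
    dist x y ≤ r ↔ (x 0 - y 0) ^ 2 + (x 1 - y 1) ^ 2 ≤ r ^ 2 := by
  rw [← plane_dist_sq, sq_le_sq₀ dist_nonneg hr]

theorem plane_dist_lt_iff {x y : Plane} {r : ℝ} (hr : 0 ≤ r) :
    dist x y < r ↔ (x 0 - y 0) ^ 2 + (x 1 - y 1) ^ 2 < r ^ 2 := by
  rw [← plane_dist_sq, sq_lt_sq₀ dist_nonneg hr]

theorem inter_frontier_nonempty_of_isPreconnected {V : Type*} [TopologicalSpace V] {S K : Set V}
    (hS : IsPreconnected S) (h1 : (S ∩ K).Nonempty) (h2 : (S \ K).Nonempty) :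
    (S ∩ frontier K).Nonempty := by
  by_contra hne
  have hsub : S ⊆ interior K ∪ (closure K)ᶜ := by
    intro x hx
    by_contra hcon
    simp only [mem_union, mem_compl_iff, not_or, not_not] at hcon
    exact hne ⟨x, hx, hcon.2, hcon.1⟩
  obtain ⟨x, hxS, hxK⟩ := h1
  obtain ⟨y, hyS, hyK⟩ := h2
  obtain ⟨w, -, hw1, hw2⟩ := hS _ _ isOpen_interior isClosed_closure.isOpen_compl hsub
    ⟨x, hxS, (hsub hxS).resolve_right (not_not.2 (subset_closure hxK))⟩
    ⟨y, hyS, (hsub hyS).resolve_left fun h => hyK (interior_subset h)⟩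
  exact hw2 (subset_closure (interior_subset hw1))

/-- The radial projection onto the boundary of a convex set is continuous. -/
theorem exists_radial_mem_frontier {V : Type*} [NormedAddCommGroup V] [NormedSpace ℝ V]
    {K : Set V} (hK : Convex ℝ K) (hKc : IsClosed K) {o m : V} (ho : o ∈ interior K)
    (hm : m ∈ frontier K) {U : Set V} (hU : U ∈ nhds m) :
    ∀ᶠ w in nhds m, ∃ r : ℝ, 0 < r ∧ o + r • (w - o) ∈ frontier K ∧ o + r • (w - o) ∈ U ∧
      (w ∈ K → 1 ≤ r) := by
  have hmK : m ∈ K := hKc.frontier_subset hm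
  have hmi : m ∉ interior K := hm.2
  have hcont : Continuous fun q : ℝ × V => o + q.1 • (q.2 - o) := by fun_prop
  have h1 : ∀ᶠ q : ℝ × V in nhds (1, m), o + q.1 • (q.2 - o) ∈ U := by
    apply hcont.continuousAt
    simpa using hU
  rw [nhds_prod_eq, Filter.eventually_prod_iff] at h1
  obtain ⟨pa, hpa, pb, hpb, hab⟩ := h1
  obtain ⟨ε, hε, hεpa⟩ := Metric.eventually_nhds_iff.1 hpa
  obtain ⟨η, hη0, hη⟩ : ∃ η : ℝ, 0 < η ∧ η < min ε 1 := exists_between (by positivity)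
  have hηε : η < ε := hη.trans_le (min_le_left _ _)
  have hη1 : η < 1 := hη.trans_le (min_le_right _ _)
  have hin : ∀ {w : V} {t : ℝ}, w ∈ K → 0 ≤ t → t < 1 → o + t • (w - o) ∈ interior K := by
    intro w t hw h0 h1
    have := hK.combo_interior_self_mem_interior ho hw (a := 1 - t) (b := t) (by linarith) h0
      (by ring)
    convert this using 1
    module
  have hlo : ∀ᶠ w in nhds m, o + (1 - η) • (w - o) ∈ interior K := by
    have : ContinuousAt (fun w : V => o + (1 - η) • (w - o)) m := by fun_prop
    exact this (isOpen_interior.mem_nhds (hin hmK (by linarith) (by linarith)))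
  have hhi : ∀ᶠ w in nhds m, o + (1 + η) • (w - o) ∉ K := by
    have : ContinuousAt (fun w : V => o + (1 + η) • (w - o)) m := by fun_prop
    refine this (hKc.isOpen_compl.mem_nhds fun hmem => hmi ?_)
    have := hin hmem (t := (1 + η)⁻¹) (by positivity) (inv_lt_one_of_one_lt₀ (by linarith))
    rwa [add_sub_cancel_left, smul_smul, inv_mul_cancel₀ (by positivity), one_smul,
      add_sub_cancel] at this
  filter_upwards [hlo, hhi, hpb] with w hwlo hwhi hwb
  have hpre : IsPreconnected ((fun t : ℝ => o + t • (w - o)) '' Icc (1 - η) (1 + η)) :=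
    isPreconnected_Icc.image _ (by fun_prop)
  obtain ⟨_, ⟨r, hr, rfl⟩, hrf⟩ := inter_frontier_nonempty_of_isPreconnected hpre (K := K)
    ⟨_, ⟨1 - η, ⟨le_rfl, by linarith⟩, rfl⟩, interior_subset hwlo⟩
    ⟨_, ⟨1 + η, ⟨by linarith, le_rfl⟩, rfl⟩, hwhi⟩
  refine ⟨r, by linarith [hr.1], hrf, hab (hεpa ?_) hwb, fun hw => ?_⟩
  · rw [Real.dist_eq, abs_lt]
    constructor <;> linarith [hr.1, hr.2]
  · by_contra! hlt
    exact hrf.2 (hin hw (by linarith [hr.1]) hlt)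

/-- A disk which locally contains the boundary of a planar convex body locally contains the
body itself. -/
theorem eventually_mem_closedBall {K : Set Plane} (hK : Convex ℝ K) (hKc : IsClosed K)
    (hKi : (interior K).Nonempty) {m z : Plane} (hm : m ∈ frontier K) {r : ℝ}
    (hz : dist m z = r) {U : Set Plane} (hU : U ∈ nhds m)
    (hUK : U ∩ frontier K ⊆ Metric.closedBall z r) :
    ∀ᶠ w in nhds m, w ∈ K → dist w z ≤ r := by
  have hr : 0 ≤ r := hz ▸ dist_nonneg
  have hmK : m ∈ K := hKc.frontier_subset hm
  obtain ⟨o, ho, hoz⟩ : ∃ o ∈ interior K, o ∈ Metric.closedBall z r := by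
    by_contra! hne
    obtain ⟨o, ho⟩ := hKi
    obtain ⟨f, u, hf1, hf2⟩ := geometric_hahn_banach_open hK.interior isOpen_interior
      (convex_closedBall z r) (disjoint_left.2 hne)
    have hfK : ∀ x ∈ K, f x ≤ u := by
      have : closure (interior K) ⊆ {x | f x ≤ u} :=
        closure_minimal (fun x hx => (hf1 x hx).le) (isClosed_le f.continuous continuous_const)
      rw [hK.closure_interior_eq_closure_of_nonempty_interior ⟨o, ho⟩, hKc.closure_eq] at this
      exact this
    have hfm : f m = u := le_antisymm (hfK m hmK) (hf2 m (by simp [hz]))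
    obtain ⟨v, hv, hfv⟩ : ∃ v : Plane, v ≠ 0 ∧ f v = 0 := by
      have hfx : ∀ x : Plane, f x = x 0 * f !₂[1, 0] + x 1 * f !₂[0, 1] := by
        intro x
        rw [← smul_eq_mul, ← smul_eq_mul, ← map_smul, ← map_smul, ← map_add]
        congr 1
        ext i; fin_cases i <;> simp
      refine ⟨!₂[-f !₂[0, 1], f !₂[1, 0]], fun h0 => ?_, ?_⟩
      · have h00 := congrFun (congrArg WithLp.ofLp h0) 0
        have h01 := congrFun (congrArg WithLp.ofLp h0) 1
        simp at h00 h01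
        have := hf1 o ho
        rw [← hfm, hfx o, hfx m, h00, h01] at this
        simp at this
      · rw [hfx]; simp; ring
    have hev := exists_radial_mem_frontier hK hKc ho hm hU
    have hball : ∀ᶠ w in nhds m, f w = u → dist w z ≤ r := by
      filter_upwards [hev] with w hw hfw
      obtain ⟨t, _, htf, htU, -⟩ := hw
      have h1 := hf2 _ (hUK ⟨htU, htf⟩)
      have h2 := hfK _ (hKc.frontier_subset htf)
      have h3 := hf1 o ho
      have h4 : f (o + t • (w - o)) = f o + t * (u - f o) := by simp [hfw]
      have h5 : t = 1 := by
        have : (t - 1) * (u - f o) = 0 := by linarith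
        rcases mul_eq_zero.1 this with h | h <;> linarith
      subst h5
      simpa using hUK ⟨htU, htf⟩
    have hc : ∀ v : Plane, Filter.Tendsto (fun t : ℝ => m + t • v) (nhds 0) (nhds m) := by
      intro v
      have : ContinuousAt (fun t : ℝ => m + t • v) 0 := by fun_prop
      simpa [ContinuousAt] using this
    obtain ⟨t, ⟨ht1, ht2⟩, ht0⟩ := ((((hc v).eventually hball).and
      ((hc (-v)).eventually hball)).filter_mono nhdsWithin_le_nhds |>.and
        (self_mem_nhdsWithin (s := Ioi (0 : ℝ)))).exists
    have k1 := (plane_dist_le_iff hr).1 (ht1 (by simp [hfv, hfm]))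
    have k2 := (plane_dist_le_iff hr).1 (ht2 (by simp [hfv, hfm]))
    have k3 := plane_dist_sq m z
    rw [hz] at k3
    simp at k1 k2
    have k4 : t ^ 2 * (v 0 ^ 2 + v 1 ^ 2) ≤ 0 := by nlinarith
    have ht0' : (0 : ℝ) < t := ht0
    have k5 : v 0 ^ 2 + v 1 ^ 2 ≤ 0 := by
      by_contra! hcon
      have := mul_pos (pow_pos ht0' 2) hcon
      linarith
    apply hv
    ext i
    fin_cases i
    · simp; nlinarith [sq_nonneg (v 0), sq_nonneg (v 1)]
    · simp; nlinarith [sq_nonneg (v 0), sq_nonneg (v 1)]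
  filter_upwards [exists_radial_mem_frontier hK hKc ho hm hU] with w hw hwK
  obtain ⟨t, ht0, htf, htU, ht1⟩ := hw
  have h1 := ht1 hwK
  have := (convex_closedBall z r) hoz (hUK ⟨htU, htf⟩) (a := 1 - t⁻¹) (b := t⁻¹)
    (sub_nonneg.2 (inv_le_one_of_one_le₀ h1)) (by positivity) (by ring)
  have e : (1 - t⁻¹) • o + t⁻¹ • (o + t • (w - o)) = w := by
    rw [smul_add, smul_smul, inv_mul_cancel₀ ht0.ne']; module
  rw [e] at this
  exact this

/-- A disk of radius larger than one is not locally contained in a unit disk near a common boundary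
point. -/
theorem not_eventually_ball_subset_unit_ball {m z c : Plane} {R : ℝ} (hz : dist m z = 1)
    (hc : dist m c = R) (hR : 1 < R) :
    ¬ ∀ᶠ w in nhds m, dist w c < R → dist w z ≤ 1 := by
  intro hev
  have hR0 : 0 ≤ R := by linarith
  obtain ⟨κ, hκ, hκ0⟩ : ∃ κ : ℝ, κ < 1 ∧ 1 < κ * R := by
    refine ⟨(1 + 1 / R) / 2, ?_, ?_⟩
    · have : 1 / R < 1 := by rw [div_lt_one] <;> linarith
      linarith
    · have : (1 + 1 / R) / 2 * R = (R + 1) / 2 := by field_simp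
      linarith
  have hκp : 0 < κ := by
    by_contra! h
    nlinarith
  set b0 := m 0 - c 0
  set b1 := m 1 - c 1
  let w : ℝ → ℝ → Plane := fun σ t =>
    !₂[m 0 - t * b0 - σ * √(2 * t * κ - t ^ 2) * b1, m 1 - t * b1 + σ * √(2 * t * κ - t ^ 2) * b0]
  have hw : ∀ σ, Filter.Tendsto (w σ) (nhds 0) (nhds m) := by
    intro σ
    have : Continuous (w σ) := by
      simp only [w]
      fun_prop
    have h0 : w σ 0 = m := by
      ext i; fin_cases i <;> simp [w]
    simpa [ContinuousAt, h0] using this.continuousAt (x := 0)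
  have hsm : ∀ᶠ t : ℝ in nhds 0, t < 2 * κ := eventually_lt_nhds (by linarith)
  obtain ⟨t, ⟨⟨ht1, ht2⟩, ht3⟩, ht0⟩ := (((((hw 1).eventually hev).and
    ((hw (-1)).eventually hev)).and hsm).filter_mono nhdsWithin_le_nhds |>.and
      (self_mem_nhdsWithin (s := Ioi (0 : ℝ)))).exists
  have ht0' : (0 : ℝ) < t := ht0
  have hb := plane_dist_sq m c
  have ha := plane_dist_sq m z
  rw [hc] at hb
  rw [hz] at ha
  set β := √(2 * t * κ - t ^ 2) with hβ
  have hβ2 : β ^ 2 = 2 * t * κ - t ^ 2 := sq_sqrt (by nlinarith)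
  rw [plane_dist_lt_iff hR0, plane_dist_le_iff zero_le_one] at ht1 ht2
  simp only [w, Matrix.cons_val_zero, Matrix.cons_val_one] at ht1 ht2
  rw [← hβ] at ht1 ht2
  set a0 := m 0 - z 0 with ha0
  set a1 := m 1 - z 1 with ha1
  have hb' : R ^ 2 = b0 ^ 2 + b1 ^ 2 := hb
  have hin : ∀ σ : ℝ, σ ^ 2 = 1 → (m 0 - t * b0 - σ * β * b1 - c 0) ^ 2
      + (m 1 - t * b1 + σ * β * b0 - c 1) ^ 2 < R ^ 2 := by
    intro σ hσ
    have : (m 0 - t * b0 - σ * β * b1 - c 0) ^ 2 + (m 1 - t * b1 + σ * β * b0 - c 1) ^ 2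
        = ((1 - t) ^ 2 + σ ^ 2 * β ^ 2) * R ^ 2 := by
      rw [hb']; simp only [b0, b1]; ring
    rw [this, hσ, hβ2]
    have : 0 < t * (1 - κ) * R ^ 2 := by
      have : 0 < 1 - κ := by linarith
      positivity
    nlinarith
  have k1 := ht1 (hin 1 (by norm_num))
  have k2 := ht2 (hin (-1) (by norm_num))
  have k3 : κ * R ^ 2 ≤ a0 * b0 + a1 * b1 := by
    have e1 : (m 0 - t * b0 - 1 * β * b1 - z 0) ^ 2 + (m 1 - t * b1 + 1 * β * b0 - z 1) ^ 2
      + ((m 0 - t * b0 - -1 * β * b1 - z 0) ^ 2 + (m 1 - t * b1 + -1 * β * b0 - z 1) ^ 2)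
      = 2 * (a0 ^ 2 + a1 ^ 2) - 4 * t * (a0 * b0 + a1 * b1)
        + 2 * (t ^ 2 + β ^ 2) * (b0 ^ 2 + b1 ^ 2) := by
      simp only [ha0, ha1]; ring
    rw [← hb', ← ha, hβ2] at e1
    have : t * (κ * R ^ 2) ≤ t * (a0 * b0 + a1 * b1) := by linarith
    exact le_of_mul_le_mul_left this ht0'
  have k4 : a0 * b0 + a1 * b1 ≤ R := by
    apply abs_le_of_sq_le_sq' _ hR0 |>.2
    have : (a0 * b0 + a1 * b1) ^ 2 + (a0 * b1 - a1 * b0) ^ 2 = 1 ^ 2 * R ^ 2 := by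
      rw [ha, hb']; ring
    have h2 := sq_nonneg (a0 * b1 - a1 * b0)
    rw [one_pow, one_mul] at this
    exact (le_add_of_nonneg_right h2).trans this.le
  have k5 : R < κ * R ^ 2 := by
    calc R = 1 * R := (one_mul R).symm
      _ < κ * R * R := by gcongr
      _ = κ * R ^ 2 := by ring
  exact absurd (k3.trans k4) (not_le.2 k5)

set_option maxHeartbeats 400000 in
/-- One side of the spindle spanned by two interior points lies in the body. -/
theorem mem_of_spindle_half {K : Set Plane} (hKc : IsCompact K) (hK : Convex ℝ K)
    (hL : IsLambdaConvex 1 K) {p q : Plane} (hp : p ∈ interior K) (hq : q ∈ interior K) {c : ℝ}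
    (hc : 4 < (1 + c ^ 2) * dist p q ^ 2) (hc0 : 0 ≤ c) {x : Plane}
    (h0 : 0 ≤ (x 1 - p 1) * (q 0 - p 0) - (x 0 - p 0) * (q 1 - p 1))
    (h1 : (x 0 - p 0) * (x 0 - q 0) + (x 1 - p 1) * (x 1 - q 1)
      + c * ((x 1 - p 1) * (q 0 - p 0) - (x 0 - p 0) * (q 1 - p 1)) ≤ 0) : x ∈ K := by
  have hKi : (interior K).Nonempty := ⟨p, hp⟩
  set v0 := q 0 - p 0 with hv0
  set v1 := q 1 - p 1 with hv1
  set h : Plane → ℝ := fun x => (x 1 - p 1) * v0 - (x 0 - p 0) * v1 with hh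
  set A : Plane → ℝ := fun x => (x 0 - p 0) * (x 0 - q 0) + (x 1 - p 1) * (x 1 - q 1) with hA
  have hhc : Continuous h := by simp only [hh]; fun_prop
  have hAc : Continuous A := by simp only [hA]; fun_prop
  have hV : dist p q ^ 2 = v0 ^ 2 + v1 ^ 2 := by rw [plane_dist_sq]; ring
  have hVp : 0 < v0 ^ 2 + v1 ^ 2 := by
    rw [← hV]; by_contra! hcon
    nlinarith [sq_nonneg (dist p q), sq_nonneg c]
  -- interior points of the segment
  have hseg : ∀ y : Plane, h y = 0 → A y ≤ 0 → y ∈ interior K := by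
    intro y hy0 hyA
    set t := ((y 0 - p 0) * v0 + (y 1 - p 1) * v1) / (v0 ^ 2 + v1 ^ 2) with ht
    have ht' : t * (v0 ^ 2 + v1 ^ 2) = (y 0 - p 0) * v0 + (y 1 - p 1) * v1 := by
      rw [ht]; field_simp
    have hy0' : (y 1 - p 1) * v0 - (y 0 - p 0) * v1 = 0 := hy0
    have e0 : y 0 - p 0 = t * v0 := by
      have : (v0 ^ 2 + v1 ^ 2) * (y 0 - p 0 - t * v0) = 0 :=
          by linear_combination (-v1) * hy0' - v0 * ht'
      have := (mul_eq_zero.1 this).resolve_left hVp.ne'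
      linarith
    have e1 : y 1 - p 1 = t * v1 := by
      have : (v0 ^ 2 + v1 ^ 2) * (y 1 - p 1 - t * v1) = 0 :=
          by linear_combination (v0) * hy0' - v1 * ht'
      have := (mul_eq_zero.1 this).resolve_left hVp.ne'
      linarith
    have hAt : A y = t * (t - 1) * (v0 ^ 2 + v1 ^ 2) := by
      have e2 : y 0 - q 0 = (t - 1) * v0 := by rw [hv0] at e0 ⊢; linarith
      have e3 : y 1 - q 1 = (t - 1) * v1 := by rw [hv1] at e1 ⊢; linarith
      simp only [hA]; rw [e0, e1, e2, e3]; ring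
    have htt : t * (t - 1) ≤ 0 := by
      by_contra! hcon
      rw [hAt] at hyA
      have := mul_pos hcon hVp
      linarith
    have ht01 : 0 ≤ t ∧ t ≤ 1 := by constructor <;> nlinarith
    have := hK.interior hp hq (a := 1 - t) (b := t) (by linarith) ht01.1 (by ring)
    convert this using 1
    ext i; fin_cases i
    · simp; linarith
    · simp; linarith
  -- convexity of the circular segments
  have hconv : ∀ k : ℝ, ConvexOn ℝ univ (fun y => A y + k * h y) := by
    intro k
    refine ⟨convex_univ, fun y _ w _ a b ha hb hab => ?_⟩
    obtain rfl : b = 1 - a := by linarith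
    have : a • (A y + k * h y) + (1 - a) • (A w + k * h w)
        - (A (a • y + (1 - a) • w) + k * h (a • y + (1 - a) • w))
        = a * (1 - a) * ((y 0 - w 0) ^ 2 + (y 1 - w 1) ^ 2) := by
      simp [hA, hh]; ring
    have h3 : 0 ≤ a * (1 - a) * ((y 0 - w 0) ^ 2 + (y 1 - w 1) ^ 2) := by positivity
    change A (a • y + (1 - a) • w) + k * h (a • y + (1 - a) • w)
      ≤ a • (A y + k * h y) + (1 - a) • (A w + k * h w)
    linarith
  have hhconv : ConcaveOn ℝ univ h := by
    refine ⟨convex_univ, fun y _ w _ a b ha hb hab => le_of_eq ?_⟩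
    obtain rfl : b = 1 - a := by linarith
    simp [hh]; ring
  obtain ⟨o, hoh, hoA⟩ : ∃ o : Plane, h o = 0 ∧ A o < 0 := by
    refine ⟨!₂[(p 0 + q 0) / 2, (p 1 + q 1) / 2], ?_, ?_⟩
    · simp [hh, hv0, hv1]; ring
    · have : A !₂[(p 0 + q 0) / 2, (p 1 + q 1) / 2] = -(v0 ^ 2 + v1 ^ 2) / 4 := by
        simp [hA, hv0, hv1]; ring
      rw [this]; linarith
  have hoK : o ∈ K := interior_subset (hseg o hoh hoA.le)
  by_contra hxK
  set F : Set Plane := {y | y ∈ frontier K ∧ 0 ≤ h y ∧ A y + c * h y ≤ 0} with hF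
  have hFc : IsCompact F := by
    have hfr : IsCompact (frontier K) :=
        hKc.of_isClosed_subset isClosed_frontier hKc.isClosed.frontier_subset
    have : F = frontier K ∩ ({y | 0 ≤ h y} ∩ {y | A y + c * h y ≤ 0}) := rfl
    rw [this]
    exact hfr.inter_right ((isClosed_le continuous_const hhc).inter
      (isClosed_le (by fun_prop) continuous_const))
  have hFh : ∀ y ∈ F, 0 < h y := by
    intro y hy
    rcases hy.2.1.eq_or_lt with h2 | h2
    · exact absurd (hseg y h2.symm (by have := hy.2.2; rw [← h2] at this; simpa using this)) hy.1.2
    · exact h2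
  have hFne : F.Nonempty := by
    have hcv : Convex ℝ ({y ∈ univ | 0 ≤ h y} ∩ {y ∈ univ | A y + c * h y ≤ 0}) :=
      (hhconv.convex_ge 0).inter ((hconv c).convex_le 0)
    obtain ⟨y, hy1, hy2⟩ := inter_frontier_nonempty_of_isPreconnected hcv.isPreconnected (K := K)
      ⟨o, ⟨⟨trivial, hoh.ge⟩, trivial, by simp [hoh, hoA.le]⟩, hoK⟩ ⟨x,
          ⟨⟨trivial, h0⟩, trivial, h1⟩, hxK⟩
    exact ⟨y, hy2, hy1.1.2, hy1.2.2⟩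
  obtain ⟨m, hmF, hmax⟩ := hFc.exists_isMaxOn hFne (f := fun y => -A y / h y)
    (ContinuousOn.div hAc.neg.continuousOn hhc.continuousOn fun y hy => (hFh y hy).ne')
  have hmh := hFh m hmF
  set k := -A m / h m with hk
  have hkm : A m + k * h m = 0 := by rw [hk]; field_simp; ring
  have hck : c ≤ k := by
    rw [hk, le_div_iff₀ hmh]; linarith [hmF.2.2]
  have hD : ∀ y, 0 ≤ h y → A y + k * h y < 0 → y ∈ K := by
    intro y hy0 hyA
    by_contra hyK
    have hcv : Convex ℝ ({y ∈ univ | 0 ≤ h y} ∩ {y ∈ univ | A y + k * h y < 0}) :=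
      (hhconv.convex_ge 0).inter ((hconv k).convex_lt 0)
    obtain ⟨w, hw1, hw2⟩ := inter_frontier_nonempty_of_isPreconnected hcv.isPreconnected (K := K)
      ⟨o, ⟨⟨trivial, hoh.ge⟩, trivial, by simp [hoh, hoA]⟩, hoK⟩ ⟨y,
          ⟨⟨trivial, hy0⟩, trivial, hyA⟩, hyK⟩
    have hw3 : 0 ≤ h w := hw1.1.2
    have hw4 : A w + k * h w < 0 := hw1.2.2
    have hwF : w ∈ F := ⟨hw2, hw3, by linarith [mul_le_mul_of_nonneg_right hck hw3]⟩
    have h5 : -A w / h w ≤ k := hmax hwF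
    rw [div_le_iff₀ (hFh w hwF)] at h5
    linarith
  obtain ⟨U, hU, z, hz, hUz⟩ := hL m hmF.1
  rw [div_one] at hz hUz
  have hloc := eventually_mem_closedBall hK hKc.isClosed hKi hmF.1 hz hU hUz
  set ctr : Plane := !₂[(p 0 + q 0) / 2 + k / 2 * v1, (p 1 + q 1) / 2 - k / 2 * v0] with hctr
  have hdist : ∀ w : Plane, dist w ctr ^ 2 = A w + k * h w + (1 + k ^ 2) *
      (v0 ^ 2 + v1 ^ 2) / 4 := by
    intro w
    rw [plane_dist_sq]
    simp only [hctr, hA, hh, hv0, hv1, PiLp.toLp_apply, Matrix.cons_val_zero, Matrix.cons_val_one]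
    ring
  have hm2 := hdist m
  rw [hkm, zero_add] at hm2
  have hR : 1 < dist m ctr := by
    rw [hV] at hc
    have : (1 + c ^ 2) * (v0 ^ 2 + v1 ^ 2) ≤ (1 + k ^ 2) * (v0 ^ 2 + v1 ^ 2) := by gcongr
    nlinarith [dist_nonneg (x := m) (y := ctr)]
  refine not_eventually_ball_subset_unit_ball hz rfl hR ?_
  filter_upwards [hloc, hhc.continuousAt.eventually (lt_mem_nhds hmh)] with w hw1 hw2 hw3
  refine hw1 (hD w hw2.le ?_)
  have := (sq_lt_sq₀ dist_nonneg dist_nonneg).2 hw3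
  rw [hdist w, hm2] at this
  linarith

theorem mem_of_spindle {K : Set Plane} (hKc : IsCompact K) (hK : Convex ℝ K)
    (hL : IsLambdaConvex 1 K) {p q : Plane} (hp : p ∈ interior K) (hq : q ∈ interior K) {c : ℝ}
    (hc : 4 < (1 + c ^ 2) * dist p q ^ 2) (hc0 : 0 ≤ c) {x : Plane}
    (h1 : (x 0 - p 0) * (x 0 - q 0) + (x 1 - p 1) * (x 1 - q 1)
      + c * |(x 1 - p 1) * (q 0 - p 0) - (x 0 - p 0) * (q 1 - p 1)| ≤ 0) : x ∈ K := by
  rcases le_total 0 ((x 1 - p 1) * (q 0 - p 0) - (x 0 - p 0) * (q 1 - p 1)) with h | h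
  · rw [abs_of_nonneg h] at h1
    exact mem_of_spindle_half hKc hK hL hp hq hc hc0 h h1
  · rw [abs_of_nonpos h] at h1
    refine mem_of_spindle_half hKc hK hL hq hp (by rwa [dist_comm]) hc0 ?_ ?_
    · linarith
    · linarith

/-- **Blaschke's rolling theorem** in the plane: a body with local supporting unit disks lies in
every
unit disk that touches one of its support lines at the contact point. -/
theorem blaschke_rolling {K : Set Plane} (hKc : IsCompact K) (hK : Convex ℝ K)
    (hKi : (interior K).Nonempty) (hL : IsLambdaConvex 1 K) {p : Plane} (hp : p ∈ K) {n0 n1 : ℝ}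
    (hn : n0 ^ 2 + n1 ^ 2 = 1)
    (hsup : ∀ x ∈ K, (x 0 - p 0) * n0 + (x 1 - p 1) * n1 ≤ 0) {y : Plane} (hy : y ∈ K) :
    (y 0 - p 0) ^ 2 + (y 1 - p 1) ^ 2 ≤ 2 * ((p 0 - y 0) * n0 + (p 1 - y 1) * n1) := by
  by_contra! hcon
  have hcl : closure (interior K) = K := by
    rw [hK.closure_interior_eq_closure_of_nonempty_interior hKi, hKc.isClosed.closure_eq]
  set W : Set Plane := interior K ∩ {y | 2 * ((p 0 - y 0) * n0 + (p 1 - y 1) * n1)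
    < (y 0 - p 0) ^ 2 + (y 1 - p 1) ^ 2} with hW
  have hVo : IsOpen {y : Plane | 2 * ((p 0 - y 0) * n0 + (p 1 - y 1) * n1)
      < (y 0 - p 0) ^ 2 + (y 1 - p 1) ^ 2} := isOpen_lt (by fun_prop) (by fun_prop)
  have hWo : IsOpen W := isOpen_interior.inter hVo
  obtain ⟨y1, hy1⟩ : W.Nonempty := by
    have := mem_closure_iff.1 (hcl.symm ▸ hy) _ hVo hcon
    obtain ⟨z, hz1, hz2⟩ := this
    exact ⟨z, hz2, hz1⟩
  have hmove : ∀ (u : Plane) (z : Plane)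
      (S : Set Plane), IsOpen S → z ∈ S → ∃ t : ℝ, 0 < t ∧ z + t • u ∈ S := by
    intro u z S hS hz
    have hc : ContinuousAt (fun t : ℝ => z + t • u) 0 := by fun_prop
    have := hc.preimage_mem_nhds (by simpa using hS.mem_nhds hz)
    obtain ⟨t, ht, ht0⟩ := ((Filter.Eventually.filter_mono nhdsWithin_le_nhds this).and
      (self_mem_nhdsWithin (s := Ioi (0 : ℝ)))).exists
    exact ⟨t, ht0, ht⟩
  obtain ⟨y, hyW, hQ⟩ : ∃ y ∈ W, (y 1 - p 1) * n0 - (y 0 - p 0) * n1 ≠ 0 := by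
    by_contra! hall
    obtain ⟨t, ht, htW⟩ := hmove !₂[-n1, n0] y1 W hWo hy1
    have e1 := hall _ hy1
    have e2 := hall _ htW
    simp at e2
    have : t * (n0 ^ 2 + n1 ^ 2) = 0 := by linarith
    rw [hn] at this
    linarith
  have hyI : y ∈ interior K := hyW.1
  have hyV : 2 * ((p 0 - y 0) * n0 + (p 1 - y 1) * n1)
      < (y 0 - p 0) ^ 2 + (y 1 - p 1) ^ 2 := hyW.2
  set P := (p 0 - y 0) * n0 + (p 1 - y 1) * n1 with hP
  set Q' := (y 1 - p 1) * n0 - (y 0 - p 0) * n1 with hQ'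
  have hPpos : 0 < P := by
    obtain ⟨t, ht, htK⟩ := hmove !₂[n0, n1] y _ isOpen_interior hyI
    have := hsup _ (interior_subset htK)
    simp at this
    have e : t * (n0 ^ 2 + n1 ^ 2) = t := by rw [hn, mul_one]
    linarith
  set v0 := y 0 - p 0 with hv0
  set v1 := y 1 - p 1 with hv1
  have hV : v0 ^ 2 + v1 ^ 2 = P ^ 2 + Q' ^ 2 := by
    have : P ^ 2 + Q' ^ 2 = (n0 ^ 2 + n1 ^ 2) * (v0 ^ 2 + v1 ^ 2) := by
      simp only [hP, hQ', hv0, hv1]; ring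
    rw [this, hn, one_mul]
  have hQpos : 0 < |Q'| := abs_pos.2 hQ
  obtain ⟨σ, hσ2, hσQ⟩ : ∃ σ : ℝ, σ ^ 2 = 1 ∧ σ * Q' = -|Q'| := by
    rcases le_total 0 Q' with h | h
    · exact ⟨-1, by norm_num, by rw [abs_of_nonneg h]; ring⟩
    · exact ⟨1, by norm_num, by rw [abs_of_nonpos h]; ring⟩
  set V := v0 ^ 2 + v1 ^ 2 with hVdef
  have hVpos : 0 < V := by linarith
  obtain ⟨c, ⟨hc4, hc0⟩, hcQ⟩ : ∃ c : ℝ, (4 < (1 + c ^ 2) * V ∧ 0 < c) ∧ c < |Q'| / P := by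
    have hfc : ContinuousAt (fun c : ℝ => (1 + c ^ 2) * V) (|Q'| / P) := by fun_prop
    have h4 : 4 < (1 + (|Q'| / P) ^ 2) * V := by
      have : (1 + (|Q'| / P) ^ 2) * V = (V / P) ^ 2 := by
        rw [div_pow, sq_abs, show Q' ^ 2 = V - P ^ 2 by linarith]
        field_simp
        ring
      rw [this]
      have h2 : 2 < V / P := by rw [lt_div_iff₀ hPpos]; exact hyV
      nlinarith
    have e1 := hfc.eventually (lt_mem_nhds h4)
    have e2 := lt_mem_nhds (show 0 < |Q'| / P by positivity)
    exact (((e1.and e2).filter_mono nhdsWithin_le_nhds).and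
      (self_mem_nhdsWithin (s := Iio (|Q'| / P)))).exists
  obtain ⟨s, hs1, hs2⟩ : ∃ s, P / |Q'| < s ∧ s < 1 / c := by
    apply exists_between
    rw [div_lt_div_iff₀ hQpos hc0]
    rw [lt_div_iff₀ hPpos] at hcQ
    linarith
  rw [div_lt_iff₀ hQpos] at hs1
  rw [lt_div_iff₀ hc0] at hs2
  have hs0 : 0 < s := by
    by_contra! h
    nlinarith
  obtain ⟨ε, hε0, hε⟩ : ∃ ε : ℝ, 0 < ε ∧ ε * (1 + s ^ 2) < 1 - s * c := by
    refine ⟨(1 - s * c) / (2 * (1 + s ^ 2)), div_pos (by linarith) (by positivity), ?_⟩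
    have : (1 - s * c) / (2 * (1 + s ^ 2)) * (1 + s ^ 2) = (1 - s * c) / 2 := by field_simp
    linarith
  set w : Plane := !₂[p 0 + ε * (v0 - s * σ * v1), p 1 + ε * (v1 + s * σ * v0)] with hw
  have hw0 : w 0 = p 0 + ε * (v0 - s * σ * v1) := by simp [hw]
  have hw1 : w 1 = p 1 + ε * (v1 + s * σ * v0) := by simp [hw]
  have hwn : 0 < (w 0 - p 0) * n0 + (w 1 - p 1) * n1 := by
    have : (w 0 - p 0) * n0 + (w 1 - p 1) * n1 = ε * (-P - s * (σ * Q')) := by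
      rw [hw0, hw1]; simp only [hP, hQ', hv0, hv1]; ring
    rw [this, hσQ]
    have : 0 < -P - s * -|Q'| := by linarith
    positivity
  have hAw : (w 0 - p 0) * (w 0 - y 0) + (w 1 - p 1) * (w 1 - y 1)
      + c * |(w 1 - p 1) * (y 0 - p 0) - (w 0 - p 0) * (y 1 - p 1)| < 0 := by
    have e1 : (w 0 - p 0) * (w 0 - y 0) + (w 1 - p 1) * (w 1 - y 1)
        = ε * V * (ε * (1 + σ ^ 2 * s ^ 2) - 1) := by
      rw [hw0, hw1]; simp only [hVdef, hv0, hv1]; ring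
    have e2 : (w 1 - p 1) * (y 0 - p 0) - (w 0 - p 0) * (y 1 - p 1) = ε * V * s * σ := by
      rw [hw0, hw1]; simp only [hVdef, hv0, hv1]; ring
    have e3 : |σ| = 1 := by
      rw [← sq_eq_sq₀ (abs_nonneg _) zero_le_one, sq_abs, hσ2, one_pow]
    rw [e1, e2, abs_mul, e3, hσ2, abs_of_pos (by positivity)]
    have : 0 < ε * V := by positivity
    have h3 : ε * V * (ε * (1 + s ^ 2) - (1 - s * c)) < 0 :=
      mul_neg_of_pos_of_neg this (by linarith)
    linarith
  have hd : 4 < (1 + c ^ 2) * dist p y ^ 2 := by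
    rw [plane_dist_sq]
    have : (p 0 - y 0) ^ 2 + (p 1 - y 1) ^ 2 = V := by simp only [hVdef, hv0, hv1]; ring
    rwa [this]
  have hopen : IsOpen ({p : Plane | (w 0 - p 0) * (w 0 - y 0) + (w 1 - p 1) * (w 1 - y 1)
      + c * |(w 1 - p 1) * (y 0 - p 0) - (w 0 - p 0) * (y 1 - p 1)| < 0}
      ∩ {p : Plane | 4 < (1 + c ^ 2) * dist p y ^ 2}) :=
    (isOpen_lt (by fun_prop) continuous_const).inter (isOpen_lt continuous_const (by fun_prop))
  obtain ⟨p', ⟨hp1, hp2⟩, hp3⟩ := mem_closure_iff.1 (hcl.symm ▸ hp) _ hopen ⟨hAw, hd⟩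
  have := hsup w (mem_of_spindle hKc hK hL hp3 hyI hp2 hc0.le (le_of_lt hp1))
  linarith

/-- `x θ` is the point of `K` with outer normal `(cos θ, sin θ)`, and `K` rolls in unit disks. -/
structure IsSupport (K : Set Plane) (x : ℝ → Plane) : Prop where
  mem : ∀ θ, x θ ∈ K
  le : ∀ θ, ∀ y ∈ K, (y 0 - x θ 0) ^ 2 + (y 1 - x θ 1) ^ 2
    ≤ 2 * ((x θ 0 - y 0) * cos θ + (x θ 1 - y 1) * sin θ)

theorem exists_isSupport {K : Set Plane} (hKc : IsCompact K) (hK : Convex ℝ K)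
    (hKi : (interior K).Nonempty) (hL : IsLambdaConvex 1 K) : ∃ x, IsSupport K x := by
  have : ∀ θ : ℝ, ∃ p ∈ K, ∀ y ∈ K, y 0 * cos θ + y 1 * sin θ ≤ p 0 * cos θ + p 1 * sin θ := by
    intro θ
    obtain ⟨p, hp, hmax⟩ := hKc.exists_isMaxOn (hKi.mono interior_subset)
      (f := fun y : Plane => y 0 * cos θ + y 1 * sin θ) (by fun_prop)
    exact ⟨p, hp, fun y hy => hmax hy⟩
  choose x hx hmax using this
  refine ⟨x, hx, fun θ y hy => ?_⟩
  refine blaschke_rolling hKc hK hKi hL (hx θ) (cos_sq_add_sin_sq θ) (fun z hz => ?_) hy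
  linarith [hmax θ z hz]

theorem exists_eq_mul_cos_sin (f : Plane →L[ℝ] ℝ) :
    ∃ r, 0 ≤ r ∧ ∃ θ : ℝ, ∀ y, f y = r * (y 0 * cos θ + y 1 * sin θ) := by
  set z : ℂ := ⟨f !₂[1, 0], f !₂[0, 1]⟩
  refine ⟨‖z‖, norm_nonneg _, z.arg, fun y => ?_⟩
  have hc : ‖z‖ * cos z.arg = f !₂[1, 0] := Complex.norm_mul_cos_arg z
  have hs : ‖z‖ * sin z.arg = f !₂[0, 1] := Complex.norm_mul_sin_arg z
  have hfx : f y = y 0 * f !₂[1, 0] + y 1 * f !₂[0, 1] := by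
    rw [← smul_eq_mul, ← smul_eq_mul, ← map_smul, ← map_smul, ← map_add]
    congr 1
    ext i; fin_cases i <;> simp
  rw [hfx, ← hc, ← hs]
  ring

namespace IsSupport

variable {K : Set Plane} {x : ℝ → Plane} (h : IsSupport K x)
include h

theorem nonneg (θ : ℝ) {y : Plane} (hy : y ∈ K) :
    0 ≤ (x θ 0 - y 0) * cos θ + (x θ 1 - y 1) * sin θ := by
  have := h.le θ y hy
  nlinarith [sq_nonneg (y 0 - x θ 0), sq_nonneg (y 1 - x θ 1)]

theorem eq_of_le {θ : ℝ} {y : Plane} (hy : y ∈ K)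
    (hle : (x θ 0 - y 0) * cos θ + (x θ 1 - y 1) * sin θ ≤ 0) : y = x θ := by
  have := h.le θ y hy
  ext i
  fin_cases i
  · simp; nlinarith [sq_nonneg (y 0 - x θ 0), sq_nonneg (y 1 - x θ 1)]
  · simp; nlinarith [sq_nonneg (y 0 - x θ 0), sq_nonneg (y 1 - x θ 1)]

theorem eq_of_trig_eq {θ τ : ℝ} (hc : cos θ = cos τ) (hs : sin θ = sin τ) : x θ = x τ := by
  apply h.eq_of_le (h.mem θ)
  have := h.nonneg θ (h.mem τ)
  rw [hc, hs] at this
  linarith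

theorem periodic : Periodic x (2 * π) := fun θ =>
  h.eq_of_trig_eq (cos_add_two_pi θ) (sin_add_two_pi θ)

theorem sq_le (θ τ : ℝ) : (x θ 0 - x τ 0) ^ 2 + (x θ 1 - x τ 1) ^ 2
    ≤ (x θ 0 - x τ 0) * (cos θ - cos τ) + (x θ 1 - x τ 1) * (sin θ - sin τ) := by
  have h1 := h.le θ _ (h.mem τ)
  have h2 := h.le τ _ (h.mem θ)
  linarith

theorem dist_le (θ τ : ℝ) : dist (x θ) (x τ) ≤ |θ - τ| := by
  rw [plane_dist_le_iff (abs_nonneg _), sq_abs]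
  have h1 := h.sq_le θ τ
  have h2 : (cos θ - cos τ) ^ 2 + (sin θ - sin τ) ^ 2 ≤ (θ - τ) ^ 2 := by
    have e : (cos θ - cos τ) ^ 2 + (sin θ - sin τ) ^ 2 = 2 * (1 - cos (θ - τ)) := by
      rw [cos_sub]
      linear_combination cos_sq_add_sin_sq θ + cos_sq_add_sin_sq τ
    have := one_sub_sq_div_two_le_cos (x := θ - τ)
    linarith
  nlinarith [sq_nonneg ((x θ 0 - x τ 0) - (cos θ - cos τ)),
    sq_nonneg ((x θ 1 - x τ 1) - (sin θ - sin τ))]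

theorem lipschitz : LipschitzWith 1 x :=
  LipschitzWith.of_dist_le_mul fun θ τ => by simpa [Real.dist_eq] using h.dist_le θ τ

theorem lipschitz_coord (i : Fin 2) : LipschitzWith 1 (fun θ => x θ i) := by
  refine LipschitzWith.of_dist_le_mul fun θ τ => ?_
  refine le_trans ?_ (h.lipschitz.dist_le_mul θ τ)
  have h2 := plane_dist_sq (x θ) (x τ)
  rw [Real.dist_eq]
  apply abs_le_of_sq_le_sq _ dist_nonneg
  rw [h2]
  fin_cases i
  · simp; positivity
  · simp; positivity

theorem continuous_coord (i : Fin 2) : Continuous (fun θ => x θ i) :=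
    (h.lipschitz_coord i).continuous

theorem mem_frontier (θ : ℝ) : x θ ∈ frontier K := by
  refine ⟨subset_closure (h.mem θ), fun hi => ?_⟩
  have hc : ContinuousAt (fun t : ℝ => x θ + t • (!₂[cos θ, sin θ] : Plane)) 0 := by fun_prop
  have := hc.preimage_mem_nhds (by simpa using mem_interior_iff_mem_nhds.1 hi)
  obtain ⟨t, ht, ht0⟩ := ((Filter.Eventually.filter_mono nhdsWithin_le_nhds this).and
    (self_mem_nhdsWithin (s := Ioi (0 : ℝ)))).exists
  have h1 := h.nonneg θ ht
  have ht0' : (0 : ℝ) < t := ht0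
  simp at h1
  nlinarith [cos_sq_add_sin_sq θ]

theorem frontier_eq (hKc : IsClosed K) (hK : Convex ℝ K) (hKi : (interior K).Nonempty) :
    frontier K = range x := by
  refine Subset.antisymm (fun p hp => ?_) (range_subset_iff.2 h.mem_frontier)
  have hpK := hKc.frontier_subset hp
  obtain ⟨f, hf⟩ := geometric_hahn_banach_open_point hK.interior isOpen_interior hp.2
  have hfK : ∀ y ∈ K, f y ≤ f p := by
    have : closure (interior K) ⊆ {y | f y ≤ f p} :=
      closure_minimal (fun y hy => (hf y hy).le) (isClosed_le f.continuous continuous_const)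
    rw [hK.closure_interior_eq_closure_of_nonempty_interior hKi, hKc.closure_eq] at this
    exact this
  obtain ⟨r, hr, θ, hfx⟩ := exists_eq_mul_cos_sin f
  have hr0 : 0 < r := by
    refine lt_of_le_of_ne hr fun h0 => ?_
    obtain ⟨o, ho⟩ := hKi
    have := hf o ho
    simp [hfx, ← h0] at this
  refine ⟨θ, (h.eq_of_le hpK ?_).symm⟩
  have := hfK _ (h.mem θ)
  rw [hfx (x θ), hfx p] at this
  linarith [le_of_mul_le_mul_left this hr0]

theorem mem_of_forall_normal_nonpos (hKc : IsClosed K) (hK : Convex ℝ K) {z : Plane}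
    (hz : ∀ θ, (z 0 - x θ 0) * cos θ + (z 1 - x θ 1) * sin θ ≤ 0) : z ∈ K := by
  by_contra hzK
  obtain ⟨f, u, hf, hfz⟩ := geometric_hahn_banach_closed_point hK hKc hzK
  obtain ⟨r, hr, θ, hfx⟩ := exists_eq_mul_cos_sin f
  have h1 := hf _ (h.mem θ)
  rw [hfx] at h1 hfz
  nlinarith [mul_nonneg hr (neg_nonneg.2 (hz θ))]

theorem frontier_eq_image (hKc : IsClosed K) (hK : Convex ℝ K) (hKi : (interior K).Nonempty)
    (a : ℝ) : frontier K = x '' Icc a (a + 2 * π) := by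
  rw [h.frontier_eq hKc hK hKi]
  refine Subset.antisymm ?_ (image_subset_range _ _)
  rintro _ ⟨θ, rfl⟩
  obtain ⟨τ, hτ, hτ'⟩ := h.periodic.exists_mem_Ico (by positivity) θ a
  exact ⟨τ, Ico_subset_Icc_self hτ, hτ'.symm⟩

omit h in
/-- The velocity of a support parametrization is tangential with speed in `[0, 1]`. -/
theorem exists_speed (h : IsSupport K x) {θ u v : ℝ} (hu : HasDerivAt (fun t => x t 0) u θ)
    (hv : HasDerivAt (fun t => x t 1) v θ) :
    u = -((-u * sin θ + v * cos θ) * sin θ) ∧ v = (-u * sin θ + v * cos θ) * cos θ ∧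
      0 ≤ -u * sin θ + v * cos θ ∧ -u * sin θ + v * cos θ ≤ 1 := by
  have hn : u * cos θ + v * sin θ = 0 := by
    have hd : HasDerivAt (fun t => (x θ 0 - x t 0) * cos θ + (x θ 1 - x t 1) * sin θ)
        (-u * cos θ + -v * sin θ) θ :=
      ((hu.const_sub _).mul_const _).add ((hv.const_sub _).mul_const _)
    have hmin : IsLocalMin (fun t => (x θ 0 - x t 0) * cos θ + (x θ 1 - x t 1) * sin θ) θ := by
      refine Filter.Eventually.of_forall fun t => ?_
      simpa using h.nonneg θ (h.mem t)
    have := hmin.hasDerivAt_eq_zero hd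
    linarith
  have h1 : u = -((-u * sin θ + v * cos θ) * sin θ) := by
    linear_combination cos θ * hn - u * cos_sq_add_sin_sq θ
  have h2 : v = (-u * sin θ + v * cos θ) * cos θ := by
    linear_combination sin θ * hn - v * cos_sq_add_sin_sq θ
  refine ⟨h1, h2, ?_⟩
  set r := -u * sin θ + v * cos θ with hr
  have hu' := hasDerivAt_iff_tendsto_slope.1 hu
  have hv' := hasDerivAt_iff_tendsto_slope.1 hv
  have hcos := hasDerivAt_iff_tendsto_slope.1 (hasDerivAt_cos θ)
  have hsin := hasDerivAt_iff_tendsto_slope.1 (hasDerivAt_sin θ)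
  have hlim := ((hu'.mul hcos).add (hv'.mul hsin)).sub ((hu'.pow 2).add (hv'.pow 2))
  have : 0 ≤ u * -sin θ + v * cos θ - (u ^ 2 + v ^ 2) := by
    refine ge_of_tendsto' hlim fun t => ?_
    have := h.sq_le t θ
    simp only [slope_def_field]
    have e : (x t 0 - x θ 0) / (t - θ) * ((cos t - cos θ) / (t - θ))
        + (x t 1 - x θ 1) / (t - θ) * ((sin t - sin θ) / (t - θ))
        - (((x t 0 - x θ 0) / (t - θ)) ^ 2 + ((x t 1 - x θ 1) / (t - θ)) ^ 2)
        = ((x t 0 - x θ 0) * (cos t - cos θ) + (x t 1 - x θ 1) * (sin t - sin θ)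
          - ((x t 0 - x θ 0) ^ 2 + (x t 1 - x θ 1) ^ 2)) / (t - θ) ^ 2 := by
      generalize t - θ = k
      ring
    rw [e]
    exact div_nonneg (by linarith) (sq_nonneg _)
  have e2 : u ^ 2 + v ^ 2 = r ^ 2 := by
    have := cos_sq_add_sin_sq θ
    have e3 : u ^ 2 + v ^ 2 = (r * sin θ) ^ 2 + (r * cos θ) ^ 2 := by
      rw [← h2]; nth_rewrite 1 [h1]; ring
    rw [e3]; linear_combination r ^ 2 * this
  have e4 : u * -sin θ + v * cos θ = r := by rw [hr]; ring
  rw [e2, e4] at this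
  constructor <;> nlinarith

end IsSupport

/-- A support parametrization together with its speed and arc length. -/
structure IsSupportArc (K : Set Plane) (x : ℝ → Plane) (ρ s : ℝ → ℝ) : Prop
    extends IsSupport K x, IsArcLength ρ s where
  hasDerivAt_zero : ∀ᵐ θ, HasDerivAt (fun t => x t 0) (-(ρ θ * sin θ)) θ
  hasDerivAt_one : ∀ᵐ θ, HasDerivAt (fun t => x t 1) (ρ θ * cos θ) θ
  periodic_speed : Periodic ρ (2 * π)

theorem IsSupport.exists_isSupportArc {K : Set Plane} {x : ℝ → Plane} (h : IsSupport K x) :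
    ∃ ρ s, IsSupportArc K x ρ s := by
  set r : ℝ → ℝ := fun θ => -deriv (fun t => x t 0) θ * sin θ + deriv (fun t => x t 1) θ * cos θ
  set ρ : ℝ → ℝ := fun θ => min 1 (max 0 (r θ)) with hρ
  have hm : Measurable ρ := by
    have h0 := measurable_deriv (fun t => x t 0)
    have h1 := measurable_deriv (fun t => x t 1)
    exact measurable_const.min (measurable_const.max
      ((h0.neg.mul measurable_sin).add (h1.mul measurable_cos)))
  have h0 : ∀ θ, 0 ≤ ρ θ := fun θ => le_min zero_le_one (le_max_left _ _)
  have h1 : ∀ θ, ρ θ ≤ 1 := fun θ => min_le_left _ _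
  have hloc : LocallyIntegrable ρ := by
    refine (locallyIntegrable_const (1 : ℝ)).mono hm.aestronglyMeasurable
      (Filter.Eventually.of_forall fun θ => ?_)
    rw [norm_of_nonneg (h0 θ)]; simpa using h1 θ
  have hρint : ∀ a b, IntervalIntegrable ρ volume a b := fun a b =>
    (hloc.integrableOn_isCompact isCompact_uIcc).intervalIntegrable
  have hae : ∀ᵐ θ, HasDerivAt (fun t => x t 0) (-(ρ θ * sin θ)) θ ∧
      HasDerivAt (fun t => x t 1) (ρ θ * cos θ) θ := by
    filter_upwards [(h.lipschitz_coord 0).ae_differentiableAt_real,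
      (h.lipschitz_coord 1).ae_differentiableAt_real] with θ hd0 hd1
    obtain ⟨e1, e2, e3, e4⟩ := h.exists_speed hd0.hasDerivAt hd1.hasDerivAt
    have : ρ θ = r θ := by
      simp only [hρ]
      rw [max_eq_right e3, min_eq_right e4]
    rw [this]
    constructor
    · have := hd0.hasDerivAt; rwa [e1] at this
    · have := hd1.hasDerivAt; rwa [e2] at this
  refine ⟨ρ, fun θ => ∫ t in 0..θ, ρ t, ⟨h, ⟨hm, h0, h1, ?_, ?_⟩,
    hae.mono fun _ h => h.1, hae.mono fun _ h => h.2, fun θ => ?_⟩⟩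
  · refine LipschitzWith.of_dist_le_mul fun a b => ?_
    rw [Real.dist_eq, intervalIntegral.integral_interval_sub_left (hρint _ _) (hρint _ _)]
    have := intervalIntegral.norm_integral_le_of_norm_le_const (f := ρ) (C := 1) (a := b) (b := a)
      (fun t _ => by rw [norm_of_nonneg (h0 t)]; exact h1 t)
    simpa [Real.dist_eq] using this
  · exact (_root_.LocallyIntegrable.ae_hasDerivAt_integral hloc).mono fun θ hθ => hθ 0
  · have e : ∀ i : Fin 2, deriv (fun t => x t i) (θ + 2 * π) = deriv (fun t => x t i) θ := by
      intro i
      rw [← deriv_comp_add_const (f := fun t => x t i)]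
      congr 1
      funext t
      rw [h.periodic t]
    simp only [hρ, r, e, cos_add_two_pi, sin_add_two_pi]

namespace IsSupportArc

variable {K : Set Plane} {x : ℝ → Plane} {ρ s : ℝ → ℝ} (h : IsSupportArc K x ρ s)
include h

theorem sub_zero (a b : ℝ) : x b 0 - x a 0 = ∫ t in a..b, ρ t * -sin t := by
  rw [← integral_eq_sub_of_lipschitz (h.toIsSupport.lipschitz_coord 0) h.hasDerivAt_zero]
  exact intervalIntegral.integral_congr fun t _ => by simp

theorem sub_one (a b : ℝ) : x b 1 - x a 1 = ∫ t in a..b, ρ t * cos t :=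
  (integral_eq_sub_of_lipschitz (h.toIsSupport.lipschitz_coord 1) h.hasDerivAt_one a b).symm

theorem sub_inner (a b c d : ℝ) : (x b 0 - x a 0) * c + (x b 1 - x a 1) * d
    = ∫ t in a..b, ρ t * (-c * sin t + d * cos t) := by
  have hA := h.toIsArcLength
  rw [h.sub_zero, h.sub_one, ← intervalIntegral.integral_mul_const,
    ← intervalIntegral.integral_mul_const, ← intervalIntegral.integral_add
    ((hA.intervalIntegrable_mul (by fun_prop) a b).mul_const _)
    ((hA.intervalIntegrable_mul (by fun_prop) a b).mul_const _)]
  exact intervalIntegral.integral_congr fun t _ => by ring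

theorem sub_inner_normal (a b θ : ℝ) : (x b 0 - x a 0) * cos θ + (x b 1 - x a 1) * sin θ
    = ∫ t in a..b, ρ t * sin (θ - t) := by
  rw [h.sub_inner]
  exact intervalIntegral.integral_congr fun t _ => by simp only [sin_sub]; ring

theorem sub_inner_tangent (a b θ : ℝ) : (x b 0 - x a 0) * (-sin θ) + (x b 1 - x a 1) * cos θ
    = ∫ t in a..b, ρ t * cos (θ - t) := by
  rw [h.sub_inner]
  exact intervalIntegral.integral_congr fun t _ => by simp only [cos_sub]; ring

theorem dist_le_arc {a b : ℝ} (hab : a ≤ b) : dist (x b) (x a) ≤ s b - s a := by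
  have hA := h.toIsArcLength
  set d0 := x b 0 - x a 0 with hd0
  set d1 := x b 1 - x a 1 with hd1
  have h1 := plane_dist_sq (x b) (x a)
  set d := dist (x b) (x a) with hd
  have hdn : 0 ≤ d := dist_nonneg
  have h2 : d ^ 2 ≤ d * (s b - s a) := by
    have e : d ^ 2 = d0 * d0 + d1 * d1 := by rw [h1]; ring
    rw [e, h.sub_inner, ← hA.integral_eq, ← intervalIntegral.integral_const_mul]
    refine intervalIntegral.integral_mono_on hab (hA.intervalIntegrable_mul (by fun_prop) a b)
      ((hA.intervalIntegrable a b).const_mul _) fun t _ => ?_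
    rw [mul_comm d]
    refine mul_le_mul_of_nonneg_left ?_ (h.nonneg t)
    apply abs_le_of_sq_le_sq' _ hdn |>.2
    rw [e]
    nlinarith [sq_nonneg (d0 * cos t + d1 * sin t), cos_sq_add_sin_sq t]
  rcases hdn.eq_or_lt with h0 | h0
  · rw [← h0]; linarith [hA.monotone hab]
  · rw [pow_two] at h2
    exact le_of_mul_le_mul_left h2 h0

end IsSupportArc

/-- A half-plane condition at two normals implies the one at every normal in between. -/
theorem inner_normal_nonpos_of_between {θ₁ θ₂ τ : ℝ} (h1 : θ₁ ≤ τ) (h2 : τ ≤ θ₂) (hlt : θ₂ - θ₁ < π)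
    {p q : Plane} (hp1 : (q 0 - p 0) * cos θ₁ + (q 1 - p 1) * sin θ₁ ≤ 0)
    (hp2 : (q 0 - p 0) * cos θ₂ + (q 1 - p 1) * sin θ₂ ≤ 0) :
    (q 0 - p 0) * cos τ + (q 1 - p 1) * sin τ ≤ 0 := by
  rcases (h1.trans h2).eq_or_lt with h0 | h0
  · obtain rfl : τ = θ₁ := by linarith
    exact hp1
  have e1 : sin (θ₂ - θ₁) * cos τ = sin (θ₂ - τ) * cos θ₁ + sin (τ - θ₁) * cos θ₂ := by
    simp only [sin_sub]; ring
  have e2 : sin (θ₂ - θ₁) * sin τ = sin (θ₂ - τ) * sin θ₁ + sin (τ - θ₁) * sin θ₂ := by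
    simp only [sin_sub]; ring
  have hs : 0 < sin (θ₂ - θ₁) := sin_pos_of_pos_of_lt_pi (by linarith) hlt
  have hs1 : 0 ≤ sin (θ₂ - τ) := sin_nonneg_of_nonneg_of_le_pi (by linarith) (by linarith)
  have hs2 : 0 ≤ sin (τ - θ₁) := sin_nonneg_of_nonneg_of_le_pi (by linarith) (by linarith)
  by_contra! hcon
  have := mul_pos hs hcon
  have k1 := mul_nonpos_of_nonneg_of_nonpos hs1 hp1
  have k2 := mul_nonpos_of_nonneg_of_nonpos hs2 hp2
  have : sin (θ₂ - θ₁) * ((q 0 - p 0) * cos τ + (q 1 - p 1) * sin τ)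
      = sin (θ₂ - τ) * ((q 0 - p 0) * cos θ₁ + (q 1 - p 1) * sin θ₁)
        + sin (τ - θ₁) * ((q 0 - p 0) * cos θ₂ + (q 1 - p 1) * sin θ₂) := by
    linear_combination (q 0 - p 0) * e1 + (q 1 - p 1) * e2
  linarith

namespace IsSupport

variable {K : Set Plane} {x : ℝ → Plane} (h : IsSupport K x)
include h

theorem eq_of_mem_Icc {θ₁ θ₂ τ : ℝ} (h1 : θ₁ ≤ τ) (h2 : τ ≤ θ₂) (hlt : θ₂ - θ₁ < π)
    (he : x θ₁ = x θ₂) : x τ = x θ₁ := by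
  refine (h.eq_of_le (h.mem θ₁) ?_).symm
  refine inner_normal_nonpos_of_between h1 h2 hlt ?_ ?_
  · have := h.nonneg θ₁ (h.mem τ); linarith
  · have := h.nonneg θ₂ (h.mem τ); rw [he]; linarith

theorem ne_add_pi (hKi : (interior K).Nonempty) (θ : ℝ) : x (θ + π) ≠ x θ := by
  intro he
  have : K ⊆ {x θ} := by
    intro y hy
    refine h.eq_of_le hy ?_
    have := h.nonneg (θ + π) hy
    rw [he, cos_add_pi, sin_add_pi] at this
    linarith
  have := hKi.mono (interior_mono this)
  rw [interior_singleton] at this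
  exact this.ne_empty rfl

theorem eq_left_or_eq_right (hKi : (interior K).Nonempty) {a b c τ₁ τ₂ : ℝ} (h1 : τ₁ ∈ Icc a b)
    (h2 : τ₂ ∈ Icc b c) (hc : c ≤ a + 2 * π) (he : x τ₁ = x τ₂) :
    x τ₁ = x a ∨ x τ₁ = x b := by
  rcases lt_trichotomy (τ₂ - τ₁) π with hlt | heq | hgt
  · right
    exact (h.eq_of_mem_Icc h1.2 h2.1 hlt he).symm
  · exfalso
    apply h.ne_add_pi hKi τ₁
    rw [he]; congr 1; linarith
  · left
    have hp := h.periodic τ₁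
    have := h.eq_of_mem_Icc (θ₁ := τ₂) (θ₂ := τ₁ + 2 * π) (τ := a + 2 * π) (by linarith [h2.2])
      (by linarith [h1.1]) (by linarith) (by rw [hp, he])
    rw [h.periodic a] at this
    rw [this, he]

theorem hausdorffMeasure_image_add_le (hKi : (interior K).Nonempty) {a b c : ℝ} (hab : a ≤ b)
    (hbc : b ≤ c) (hc : c ≤ a + 2 * π) :
    μH[1] (x '' Icc a b) + μH[1] (x '' Icc b c) ≤ μH[1] (x '' Icc a c) := by
  rw [← Icc_union_Icc_eq_Icc hab hbc, image_union]
  have hm : MeasurableSet (x '' Icc b c) :=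
    (isCompact_Icc.image h.lipschitz.continuous).measurableSet
  have := Measure.nullSingletonClass_hausdorff Plane one_pos
  refine (measure_union₀ hm.nullMeasurableSet ?_).ge
  refine measure_mono_null (t := {x a, x b}) ?_ ((Set.toFinite _).measure_zero _)
  rintro _ ⟨⟨τ₁, h1, rfl⟩, ⟨τ₂, h2, he⟩⟩
  exact h.eq_left_or_eq_right hKi h1 h2 hc he.symm

end IsSupport

namespace IsSupportArc

variable {K : Set Plane} {x : ℝ → Plane} {ρ s : ℝ → ℝ} (h : IsSupportArc K x ρ s)
include h

theorem hausdorffMeasure_image_le (a b : ℝ) :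
    μH[1] (x '' Icc a b) ≤ ENNReal.ofReal (s b - s a) := by
  have hA := h.toIsArcLength
  have hd : ∀ θ τ, dist (x θ) (x τ) ≤ dist (s θ) (s τ) := by
    intro θ τ
    rcases le_total τ θ with h1 | h1
    · exact (h.dist_le_arc h1).trans (le_abs_self _)
    · rw [dist_comm, dist_comm (s θ)]; exact (h.dist_le_arc h1).trans (le_abs_self _)
  set g : ℝ → Plane := fun u => x (invFun s u) with hg
  have hgs : ∀ θ, g (s θ) = x θ := by
    intro θ
    have h1 : s (invFun s (s θ)) = s θ := invFun_eq ⟨θ, rfl⟩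
    have := hd (invFun s (s θ)) θ
    rw [h1, dist_self] at this
    exact dist_le_zero.1 this
  have hgl : LipschitzOnWith 1 g (s '' Icc a b) := by
    refine LipschitzOnWith.of_dist_le_mul ?_
    rintro _ ⟨θ, _, rfl⟩ _ ⟨τ, _, rfl⟩
    rw [hgs, hgs]; simpa using hd θ τ
  have h1 := hgl.hausdorffMeasure_image_le zero_le_one
  have e : g '' (s '' Icc a b) = x '' Icc a b := by
    rw [image_image]; exact image_congr fun θ _ => hgs θ
  rw [e] at h1
  simp only [ENNReal.coe_one, ENNReal.one_rpow, one_mul] at h1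
  refine h1.trans ?_
  rw [hausdorffMeasure_real, ← Real.volume_Icc]
  refine measure_mono ?_
  rintro _ ⟨θ, hθ, rfl⟩
  exact ⟨hA.monotone hθ.1, hA.monotone hθ.2⟩

theorem le_hausdorffMeasure_image {a b : ℝ} (hab : a ≤ b) (hb : b - a ≤ π) :
    ENNReal.ofReal (cos ((b - a) / 2) * (s b - s a)) ≤ μH[1] (x '' Icc a b) := by
  have hA := h.toIsArcLength
  set c := (a + b) / 2 with hc
  set f : Plane → ℝ := fun y => y 0 * (-sin c) + y 1 * cos c with hf
  have hfl : LipschitzWith 1 f := by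
    refine LipschitzWith.of_dist_le_mul fun y z => ?_
    rw [Real.dist_eq, NNReal.coe_one, one_mul]
    apply abs_le_of_sq_le_sq _ dist_nonneg
    rw [plane_dist_sq]
    simp only [hf]
    nlinarith [sq_nonneg ((y 0 - z 0) * cos c + (y 1 - z 1) * sin c), cos_sq_add_sin_sq c]
  have hfc : ContinuousOn (fun θ => f (x θ)) (Icc a b) :=
    (hfl.continuous.comp h.toIsSupport.lipschitz.continuous).continuousOn
  have h1 := (hfl.lipschitzOnWith (s := x '' Icc a b)).hausdorffMeasure_image_le zero_le_one
  simp only [ENNReal.coe_one, ENNReal.one_rpow, one_mul] at h1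
  refine le_trans ?_ h1
  have h2 : Icc (f (x a)) (f (x b)) ⊆ f '' (x '' Icc a b) := by
    rw [image_image]; exact intermediate_value_Icc hab hfc
  refine le_trans ?_ (measure_mono h2)
  rw [hausdorffMeasure_real, Real.volume_Icc]
  apply ENNReal.ofReal_le_ofReal
  have e : f (x b) - f (x a) = ∫ t in a..b, ρ t * cos (c - t) := by
    rw [← h.sub_inner_tangent]; simp only [hf]; ring
  rw [e, ← hA.integral_eq, ← intervalIntegral.integral_const_mul]
  refine intervalIntegral.integral_mono_on hab ((hA.intervalIntegrable a b).const_mul _)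
    (hA.intervalIntegrable_mul (by fun_prop) a b) fun t ht => ?_
  rw [mul_comm]
  refine mul_le_mul_of_nonneg_left ?_ (h.nonneg t)
  rw [← cos_abs (c - t)]
  refine cos_le_cos_of_nonneg_of_le_pi (abs_nonneg _) (by linarith [pi_pos]) ?_
  rw [abs_le]
  constructor <;> linarith [ht.1, ht.2]

theorem hausdorffMeasure_image (hKi : (interior K).Nonempty) (a : ℝ) :
    μH[1] (x '' Icc a (a + 2 * π)) = ENNReal.ofReal (s (a + 2 * π) - s a) := by
  have hA := h.toIsArcLength
  refine le_antisymm (h.hausdorffMeasure_image_le _ _) ?_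
  have key : ∀ N : ℕ, 2 ≤ N → ENNReal.ofReal (cos (π / N) * (s (a + 2 * π) - s a))
      ≤ μH[1] (x '' Icc a (a + 2 * π)) := by
    intro N hN
    have hN2 : (2 : ℝ) ≤ N := by exact_mod_cast hN
    have hN0 : (0 : ℝ) < N := by linarith
    have hcos : 0 ≤ cos (π / N) := by
      apply cos_nonneg_of_neg_pi_div_two_le_of_le
      · have : 0 < π / N := by positivity
        linarith [pi_pos]
      · gcongr
    have ind : ∀ k : ℕ, k ≤ N → ENNReal.ofReal (cos (π / N) * (s (a + k * (2 * π / N)) - s a))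
        ≤ μH[1] (x '' Icc a (a + k * (2 * π / N))) := by
      intro k
      induction k with
      | zero => intro _; simp
      | succ k ih =>
        intro hk
        have hk' : (k + 1 : ℝ) ≤ N := by exact_mod_cast hk
        have hw : 0 < 2 * π / N := by positivity
        set b := a + k * (2 * π / N) with hb
        set c := a + (k + 1 : ℕ) * (2 * π / N) with hc
        have hcb : c - b = 2 * π / N := by rw [hc, hb]; push_cast; ring
        have hab : a ≤ b := by rw [hb]; have : 0 ≤ k * (2 * π / N) := by positivity
                               linarith
        have hbc : b ≤ c := by linarith
        have hcm : c ≤ a + 2 * π := by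
          have : (k + 1 : ℝ) * (2 * π / N) ≤ N * (2 * π / N) := by gcongr
          have e : (N : ℝ) * (2 * π / N) = 2 * π := by field_simp
          rw [hc]; push_cast; linarith
        have h1 := h.le_hausdorffMeasure_image hbc (by
          rw [hcb, div_le_iff₀ hN0]; nlinarith [pi_pos])
        rw [hcb, show 2 * π / N / 2 = π / N by ring] at h1
        refine le_trans ?_ (h.toIsSupport.hausdorffMeasure_image_add_le hKi hab hbc hcm)
        refine le_trans ?_ (add_le_add (ih (by omega)) h1)
        rw [← ENNReal.ofReal_add (mul_nonneg hcos (by linarith [hA.monotone hab]))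
          (mul_nonneg hcos (by linarith [hA.monotone hbc]))]
        apply ENNReal.ofReal_le_ofReal
        linarith
    have := ind N le_rfl
    rwa [show (N : ℝ) * (2 * π / N) = 2 * π by field_simp] at this
  have hlim : Filter.Tendsto (fun N : ℕ => ENNReal.ofReal (cos (π / N) * (s (a + 2 * π) - s a)))
      Filter.atTop (nhds (ENNReal.ofReal (s (a + 2 * π) - s a))) := by
    apply ENNReal.tendsto_ofReal
    have h1 : Filter.Tendsto (fun N : ℕ => π / (N : ℝ)) Filter.atTop (nhds 0) :=
      tendsto_const_div_atTop_nhds_zero_nat π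
    have h2 := (continuous_cos.tendsto 0).comp h1
    rw [cos_zero] at h2
    simpa using h2.mul_const (s (a + 2 * π) - s a)
  exact le_of_tendsto hlim (Filter.eventually_atTop.2 ⟨2, key⟩)

/-- The perimeter is the total arc length. -/
theorem toReal_hausdorffMeasure_frontier (hKc : IsClosed K) (hK : Convex ℝ K)
    (hKi : (interior K).Nonempty) (a : ℝ) :
    (μH[1] (frontier K)).toReal = s (a + 2 * π) - s a := by
  rw [h.toIsSupport.frontier_eq_image hKc hK hKi a, h.hausdorffMeasure_image hKi,
    ENNReal.toReal_ofReal]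
  linarith [h.toIsArcLength.monotone (show a ≤ a + 2 * π by linarith [pi_pos])]

end IsSupportArc

/-- Substitution along a Lipschitz function `φ` of a function `ψ` that factors through `φ`. -/
theorem exists_continuous_factor {φ ψ φ' : ℝ → ℝ} {C : NNReal} (hφ : LipschitzWith C φ)
    (hψ : Continuous ψ) (hd : ∀ᵐ t, HasDerivAt φ (φ' t) t) {a b m M : ℝ} (hab : a ≤ b)
    (hmM : m ≤ M) (himg : φ '' Icc a b = Icc m M)
    (hcomp : ∀ t ∈ Icc a b, ∀ t' ∈ Icc a b, φ t = φ t' → ψ t = ψ t') :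
    ∃ G : ℝ → ℝ, Continuous G ∧ (∀ t ∈ Icc a b, G (φ t) = ψ t) ∧
      ∫ t in a..b, ψ t * φ' t = ∫ u in (φ a)..(φ b), G u := by
  classical
  have hinv : ∀ u ∈ Icc m M, ∃ t ∈ Icc a b, φ t = u := by
    intro u hu; rw [← himg] at hu; exact hu
  choose! τ hτ hφτ using hinv
  have hmem : ∀ t ∈ Icc a b, φ t ∈ Icc m M := fun t ht => himg ▸ mem_image_of_mem φ ht
  set G₀ : ℝ → ℝ := fun u => ψ (τ u) with hG₀
  have hG₀φ : ∀ t ∈ Icc a b, G₀ (φ t) = ψ t := fun t ht =>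
    hcomp _ (hτ _ (hmem t ht)) _ ht (hφτ _ (hmem t ht))
  have hG₀c : ContinuousOn G₀ (Icc m M) := by
    rw [continuousOn_iff_isClosed]
    intro T hT
    refine ⟨φ '' (Icc a b ∩ ψ ⁻¹' T), ?_, ?_⟩
    · exact ((isCompact_Icc.inter_right (hT.preimage hψ)).image hφ.continuous).isClosed
    · ext u
      constructor
      · rintro ⟨hu1, hu2⟩
        exact ⟨⟨τ u, ⟨hτ u hu2, hu1⟩, hφτ u hu2⟩, hu2⟩
      · rintro ⟨⟨t, ⟨ht1, ht2⟩, rfl⟩, hu2⟩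
        refine ⟨?_, hu2⟩
        rw [mem_preimage, hG₀φ t ht1]
        exact ht2
  set G : ℝ → ℝ := IccExtend hmM ((Icc m M).domRestrict G₀) with hG
  have hGc : Continuous G := (continuousOn_iff_continuous_domRestrict.1 hG₀c).Icc_extend'
  have hGφ : ∀ t ∈ Icc a b, G (φ t) = ψ t := by
    intro t ht
    rw [hG, IccExtend_of_mem _ _ (hmem t ht)]
    exact hG₀φ t ht
  refine ⟨G, hGc, hGφ, ?_⟩
  obtain ⟨B, hB⟩ := (isCompact_Icc (a := m) (b := M)).exists_bound_of_continuousOn hGc.continuousOn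
  have hGB : ∀ u, ‖G u‖ ≤ B := by
    intro u
    have : G u = G (projIcc m M hmM u) := by
      rw [hG, IccExtend_apply, IccExtend_val]
      rfl
    rw [this]
    exact hB _ (projIcc m M hmM u).2
  have hB0 : 0 ≤ B := (norm_nonneg _).trans (hGB 0)
  set F : ℝ → ℝ := fun v => ∫ u in (φ a)..v, G u with hF
  have hFd : ∀ v, HasDerivAt F (G v) v := fun v => hGc.integral_hasStrictDerivAt _ v |>.hasDerivAt
  have hFl : LipschitzWith ⟨B, hB0⟩ F :=
    lipschitzWith_of_nnnorm_deriv_le (fun v => (hFd v).differentiableAt) fun v => by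
      rw [(hFd v).deriv]; exact hGB v
  have key := integral_eq_sub_of_lipschitz (f := fun t => F (φ t)) (f' := fun t => G (φ t) * φ' t)
    (hFl.comp hφ) (hd.mono fun t ht => (hFd (φ t)).comp t ht) a b
  have e : F (φ a) = 0 := intervalIntegral.integral_same
  rw [e, _root_.sub_zero] at key
  change _ = F (φ b)
  rw [← key]
  refine intervalIntegral.integral_congr fun t ht => ?_
  rw [uIcc_of_le hab] at ht
  simp only [hGφ t ht]

theorem measurePreserving_plane_prod :
    MeasurePreserving (fun y : Plane => (y 0, y 1)) volume volume :=
  (volume_preserving_finTwoArrow ℝ).comp (PiLp.volume_preserving_ofLp (Fin 2))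

/-- Fubini for planar bodies described by their vertical sections. -/
theorem toReal_volume_eq_integral {K : Set Plane} (hK : IsClosed K) {m M : ℝ} (hmM : m ≤ M)
    {G₁ G₂ : ℝ → ℝ} (hG₁ : Continuous G₁) (hG₂ : Continuous G₂)
    (hle : ∀ u ∈ Icc m M, G₁ u ≤ G₂ u)
    (hsec : ∀ y : Plane, y ∈ K ↔ y 0 ∈ Icc m M ∧ y 1 ∈ Icc (G₁ (y 0)) (G₂ (y 0))) :
    (volume K).toReal = ∫ u in m..M, (G₂ u - G₁ u) := by
  set K' : Set (ℝ × ℝ) := {p | (!₂[p.1, p.2] : Plane) ∈ K} with hK'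
  have hK'm : MeasurableSet K' := by
    have hc : Continuous fun p : ℝ × ℝ => (!₂[p.1, p.2] : Plane) := by fun_prop
    exact (hK.preimage hc).measurableSet
  have e1 : K = (fun y : Plane => (y 0, y 1)) ⁻¹' K' := by
    ext y
    have : (!₂[y 0, y 1] : Plane) = y := by ext i; fin_cases i <;> simp
    simp [hK', this]
  have e2 : volume K = volume K' := by
    rw [e1]
    exact measurePreserving_plane_prod.measure_preimage hK'm.nullMeasurableSet
  have e3 : volume K' = ∫⁻ u, (Icc m M).indicator (fun u => ENNReal.ofReal (G₂ u - G₁ u)) u := by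
    rw [Measure.volume_eq_prod, Measure.prod_apply hK'm]
    refine lintegral_congr fun u => ?_
    by_cases hu : u ∈ Icc m M
    · rw [indicator_of_mem hu, ← Real.volume_Icc]
      congr 1
      ext v
      have := hsec !₂[u, v]
      simp [hK', this, hu.1, hu.2]
    · rw [indicator_of_notMem hu]
      have : Prod.mk u ⁻¹' K' = ∅ := by
        ext v
        have := hsec !₂[u, v]
        simp only [mem_Icc] at hu
        simp [hK', this, hu]
      rw [this, measure_empty]
  rw [e2, e3, lintegral_indicator measurableSet_Icc, intervalIntegral.integral_of_le hmM,
    ← integral_Icc_eq_integral_Ioc, integral_eq_lintegral_of_nonneg_ae]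
  · filter_upwards [ae_restrict_mem measurableSet_Icc] with u hu
    simpa using hle u hu
  · exact (hG₂.sub hG₁).aestronglyMeasurable

namespace IsSupportArc

variable {K : Set Plane} {x : ℝ → Plane} {ρ s : ℝ → ℝ} (h : IsSupportArc K x ρ s)
include h

theorem le_of_sin_nonneg {θ : ℝ} (hθ : 0 ≤ sin θ) {y : Plane} (hy : y ∈ K) (he : y 0 = x θ 0) :
    y 1 ≤ x θ 1 := by
  by_contra! hcon
  have := h.le θ y hy
  rw [he] at this
  nlinarith [mul_pos (sub_pos.2 hcon) (sub_pos.2 hcon),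
    mul_nonneg hθ (sub_nonneg.2 hcon.le)]

theorem le_of_sin_nonpos {θ : ℝ} (hθ : sin θ ≤ 0) {y : Plane} (hy : y ∈ K) (he : y 0 = x θ 0) :
    x θ 1 ≤ y 1 := by
  by_contra! hcon
  have := h.le θ y hy
  rw [he] at this
  nlinarith [mul_pos (sub_pos.2 hcon) (sub_pos.2 hcon),
    mul_nonneg (neg_nonneg.2 hθ) (sub_nonneg.2 hcon.le)]

theorem mem_Icc_of_mem {y : Plane} (hy : y ∈ K) : y 0 ∈ Icc (x π 0) (x 0 0) := by
  have h1 := h.toIsSupport.nonneg 0 hy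
  have h2 := h.toIsSupport.nonneg π hy
  simp at h1 h2
  exact ⟨h2, h1⟩

theorem toReal_volume_eq_upper (hKc : IsCompact K) (hK : Convex ℝ K) :
    (volume K).toReal = ∫ θ in 0..(2 * π), ρ θ * (x θ 1 * sin θ) := by
  have hS := h.toIsSupport
  have hA := h.toIsArcLength
  have hπ := pi_pos
  have hper : x (2 * π) = x 0 := by simpa using h.toIsSupport.periodic 0
  have hmM : x π 0 ≤ x 0 0 := (h.mem_Icc_of_mem (h.mem 0)).1
  have hsin1 : ∀ θ ∈ Icc 0 π, 0 ≤ sin θ := fun θ hθ => sin_nonneg_of_mem_Icc hθ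
  have hsin2 : ∀ θ ∈ Icc π (2 * π), sin θ ≤ 0 := by
    intro θ hθ
    have := sin_nonneg_of_mem_Icc (x := θ - π) ⟨by linarith [hθ.1], by linarith [hθ.2]⟩
    rw [sin_sub_pi] at this
    linarith
  have him1 : (fun θ => x θ 0) '' Icc 0 π = Icc (x π 0) (x 0 0) := by
    refine Subset.antisymm ?_ ?_
    · rintro _ ⟨θ, -, rfl⟩
      exact h.mem_Icc_of_mem (h.mem θ)
    · exact intermediate_value_Icc' hπ.le (hS.continuous_coord 0).continuousOn
  have him2 : (fun θ => x θ 0) '' Icc π (2 * π) = Icc (x π 0) (x 0 0) := by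
    refine Subset.antisymm ?_ ?_
    · rintro _ ⟨θ, -, rfl⟩
      exact h.mem_Icc_of_mem (h.mem θ)
    · have := intermediate_value_Icc (show π ≤ 2 * π by linarith)
          (hS.continuous_coord 0).continuousOn
      rwa [hper] at this
  obtain ⟨G₂, hG₂, hG₂x, hI₂⟩ := exists_continuous_factor (hS.lipschitz_coord 0)
    (hS.continuous_coord 1) h.hasDerivAt_zero hπ.le hmM him1 fun t ht t' ht' he =>
      le_antisymm (h.le_of_sin_nonneg (hsin1 t' ht') (h.mem t) he)
        (h.le_of_sin_nonneg (hsin1 t ht) (h.mem t') he.symm)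
  obtain ⟨G₁, hG₁, hG₁x, hI₁⟩ := exists_continuous_factor (hS.lipschitz_coord 0)
    (hS.continuous_coord 1) h.hasDerivAt_zero (show π ≤ 2 * π by linarith) hmM him2
      fun t ht t' ht' he =>
        le_antisymm (h.le_of_sin_nonpos (hsin2 t ht) (h.mem t') he.symm)
          (h.le_of_sin_nonpos (hsin2 t' ht') (h.mem t) he)
  have hG : ∀ u ∈ Icc (x π 0) (x 0 0), ∃ θ₁ ∈ Icc π (2 * π), ∃ θ₂ ∈ Icc 0 π, x θ₁ 0 = u ∧
      x θ₂ 0 = u ∧ G₁ u = x θ₁ 1 ∧ G₂ u = x θ₂ 1 := by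
    intro u hu
    obtain ⟨θ₁, hθ₁, e1⟩ := him2.symm ▸ hu
    obtain ⟨θ₂, hθ₂, e2⟩ := him1.symm ▸ hu
    simp only at e1 e2
    exact ⟨θ₁, hθ₁, θ₂, hθ₂, e1, e2, by rw [← e1, hG₁x _ hθ₁], by rw [← e2, hG₂x _ hθ₂]⟩
  rw [toReal_volume_eq_integral hKc.isClosed hmM hG₁ hG₂]
  · rw [intervalIntegral.integral_sub (hG₂.intervalIntegrable _ _) (hG₁.intervalIntegrable _ _)]
    simp only [hper] at hI₁
    rw [intervalIntegral.integral_symm (x π 0) (x 0 0)] at hI₂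
    have hi : ∀ a b, IntervalIntegrable (fun t => x t 1 * -(ρ t * sin t)) volume a b := by
      intro a b
      have := (hA.intervalIntegrable_mul (k := fun θ => x θ 1 * sin θ)
        ((hS.continuous_coord 1).mul continuous_sin) a b).neg
      exact this.congr fun t _ => by simp only [Pi.neg_apply]; ring
    have hadd := intervalIntegral.integral_add_adjacent_intervals (hi 0 π) (hi π (2 * π))
    have hneg : ∫ t in 0..(2 * π), x t 1 * -(ρ t * sin t)
        = -∫ θ in 0..(2 * π), ρ θ * (x θ 1 * sin θ) := by
      rw [← intervalIntegral.integral_neg]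
      exact intervalIntegral.integral_congr fun t _ => by ring
    linarith
  · intro u hu
    obtain ⟨θ₁, hθ₁, θ₂, hθ₂, e1, e2, e3, e4⟩ := hG u hu
    rw [e3, e4]
    exact h.le_of_sin_nonneg (hsin1 _ hθ₂) (h.mem θ₁) (e1.trans e2.symm)
  · intro y
    constructor
    · intro hy
      have hy0 := h.mem_Icc_of_mem hy
      obtain ⟨θ₁, hθ₁, θ₂, hθ₂, e1, e2, e3, e4⟩ := hG _ hy0
      rw [e3, e4]
      exact ⟨hy0, h.le_of_sin_nonpos (hsin2 _ hθ₁) hy e1.symm,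
        h.le_of_sin_nonneg (hsin1 _ hθ₂) hy e2.symm⟩
    · rintro ⟨hy0, hy1⟩
      obtain ⟨θ₁, hθ₁, θ₂, hθ₂, e1, e2, e3, e4⟩ := hG _ hy0
      rw [e3, e4] at hy1
      obtain ⟨a, b, ha, hb, hab, e⟩ := (segment_eq_Icc (hy1.1.trans hy1.2)).symm ▸ hy1
      have := hK (h.mem θ₁) (h.mem θ₂) ha hb hab
      convert this using 1
      ext i
      fin_cases i
      · simp [e1, e2, ← add_mul, hab]
      · simpa using e.symm

theorem toReal_volume_eq (hKc : IsCompact K) (hK : Convex ℝ K) (a : ℝ) (o : Plane) :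
    (volume K).toReal = (∫ θ in a..(a + 2 * π),
      ρ θ * ((x θ 0 - o 0) * cos θ + (x θ 1 - o 1) * sin θ)) / 2 := by
  have hS := h.toIsSupport
  have hA := h.toIsArcLength
  have hc0 := hS.continuous_coord 0
  have hc1 := hS.continuous_coord 1
  have hper : x (2 * π) = x 0 := by simpa using h.toIsSupport.periodic 0
  have hf : Periodic (fun θ => ρ θ * ((x θ 0 - o 0) * cos θ + (x θ 1 - o 1) * sin θ)) (2 * π) := by
    intro θ
    simp only [h.periodic_speed θ, hS.periodic θ, cos_add_two_pi, sin_add_two_pi]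
  rw [hf.intervalIntegral_add_eq a 0, zero_add]
  have hparts : ∫ θ in 0..(2 * π), ρ θ * (x θ 0 * cos θ - x θ 1 * sin θ) = 0 := by
    obtain ⟨B, hB⟩ : ∃ B : ℝ, ∀ θ, |x θ 0| ≤ B ∧ |x θ 1| ≤ B := by
      obtain ⟨B, hB⟩ := hKc.isBounded.exists_norm_le
      refine ⟨B, fun θ => ⟨?_, ?_⟩⟩
      · exact (PiLp.norm_apply_le (x θ) 0).trans (hB _ (h.mem θ))
      · exact (PiLp.norm_apply_le (x θ) 1).trans (hB _ (h.mem θ))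
    have hB0 : 0 ≤ B := (abs_nonneg _).trans (hB 0).1
    have hl : LipschitzWith ⟨2 * B, by positivity⟩ (fun θ => x θ 0 * x θ 1) := by
      refine LipschitzWith.of_dist_le_mul fun θ τ => ?_
      have h0 := (hS.lipschitz_coord 0).dist_le_mul θ τ
      have h1 := (hS.lipschitz_coord 1).dist_le_mul θ τ
      simp only [NNReal.coe_one, one_mul, Real.dist_eq] at h0 h1
      change |x θ 0 * x θ 1 - x τ 0 * x τ 1| ≤ 2 * B * |θ - τ|
      have e : x θ 0 * x θ 1 - x τ 0 * x τ 1
          = (x θ 0 - x τ 0) * x θ 1 + x τ 0 * (x θ 1 - x τ 1) := by ring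
      rw [e]
      refine (abs_add_le _ _).trans ?_
      rw [abs_mul, abs_mul]
      have k1 := mul_le_mul h0 (hB θ).2 (abs_nonneg _) (abs_nonneg _)
      have k2 := mul_le_mul (hB τ).1 h1 (abs_nonneg _) hB0
      linarith
    have := integral_eq_sub_of_lipschitz hl
      (f' := fun θ => ρ θ * (x θ 0 * cos θ - x θ 1 * sin θ)) ?_ 0 (2 * π)
    · rw [this, hper, sub_self]
    · filter_upwards [h.hasDerivAt_zero, h.hasDerivAt_one] with θ h0 h1
      exact (h0.mul h1).congr_deriv (by ring)
  have hu := h.toReal_volume_eq_upper hKc hK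
  have hz0 := h.sub_zero 0 (2 * π)
  have hz1 := h.sub_one 0 (2 * π)
  rw [hper, sub_self] at hz0 hz1
  have i1 := hA.intervalIntegrable_mul (k := fun θ => x θ 0 * cos θ - x θ 1 * sin θ)
    ((hc0.mul continuous_cos).sub (hc1.mul continuous_sin)) 0 (2 * π)
  have i2 := hA.intervalIntegrable_mul (k :=
      fun θ => x θ 1 * sin θ) (hc1.mul continuous_sin) 0 (2 * π)
  have i3 := hA.intervalIntegrable_mul (k := fun θ => -sin θ) continuous_sin.neg 0 (2 * π)
  have i4 := hA.intervalIntegrable_mul (k := fun θ => cos θ) continuous_cos 0 (2 * π)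
  have e : ∫ θ in 0..(2 * π), ρ θ * ((x θ 0 - o 0) * cos θ + (x θ 1 - o 1) * sin θ)
      = (∫ θ in 0..(2 * π), ρ θ * (x θ 0 * cos θ - x θ 1 * sin θ))
        + 2 * (∫ θ in 0..(2 * π), ρ θ * (x θ 1 * sin θ))
        + o 1 * (∫ θ in 0..(2 * π), ρ θ * -sin θ) - o 0 * ∫ θ in 0..(2 * π), ρ θ * cos θ := by
    rw [← intervalIntegral.integral_const_mul, ← intervalIntegral.integral_const_mul,
      ← intervalIntegral.integral_const_mul, ← intervalIntegral.integral_add i1 (i2.const_mul _),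
      ← intervalIntegral.integral_add (i1.add (i2.const_mul _)) (i3.const_mul _),
      ← intervalIntegral.integral_sub ((i1.add (i2.const_mul _)).add (i3.const_mul _))
        (i4.const_mul _)]
    exact intervalIntegral.integral_congr fun t _ => by ring
  rw [e, hparts, ← hu, ← hz0, ← hz1]
  ring

/-- The area splits into the contributions of two halves of the boundary. -/
theorem two_mul_toReal_volume (hKc : IsCompact K) (hK : Convex ℝ K) (a : ℝ) :
    2 * (volume K).toReal = (∫ θ in a..(a + π), ρ θ * ∫ τ in a..θ, ρ τ * sin (θ - τ))
      + ∫ θ in (a + π)..(a + π + π), ρ θ * ∫ τ in (a + π)..θ, ρ τ * sin (θ - τ) := by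
  have hS := h.toIsSupport
  have hA := h.toIsArcLength
  have hc0 := hS.continuous_coord 0
  have hc1 := hS.continuous_coord 1
  have hi : ∀ o : Plane, ∀ a b : ℝ, IntervalIntegrable
      (fun θ => ρ θ * ((x θ 0 - o 0) * cos θ + (x θ 1 - o 1) * sin θ)) volume a b := fun o a b =>
    hA.intervalIntegrable_mul
      (k := fun θ => (x θ 0 - o 0) * cos θ + (x θ 1 - o 1) * sin θ)
      (((hc0.sub continuous_const).mul continuous_cos).add
        ((hc1.sub continuous_const).mul continuous_sin)) a b
  have hv := h.toReal_volume_eq hKc hK a (x a)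
  rw [show a + 2 * π = a + π + π by ring,
    ← intervalIntegral.integral_add_adjacent_intervals (hi _ a (a + π)) (hi _ (a + π) _)] at hv
  have e1 : ∀ b c : ℝ, ∫ θ in b..c, ρ θ * ∫ τ in b..θ, ρ τ * sin (θ - τ)
      = ∫ θ in b..c, ρ θ * ((x θ 0 - x b 0) * cos θ + (x θ 1 - x b 1) * sin θ) := fun b c =>
    intervalIntegral.integral_congr fun θ _ => by simp only [h.sub_inner_normal]
  have e2 : ∫ θ in (a + π)..(a + π + π), ρ θ * ((x θ 0 - x a 0) * cos θ + (x θ 1 - x a 1) * sin θ)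
      = ∫ θ in (a + π)..(a + π + π),
        ρ θ * ((x θ 0 - x (a + π) 0) * cos θ + (x θ 1 - x (a + π) 1) * sin θ) := by
    have hz0 := h.sub_zero (a + π) (a + π + π)
    have hz1 := h.sub_one (a + π) (a + π + π)
    have hper : x (a + π + π) = x a := by rw [← h.toIsSupport.periodic a]; congr 1; ring
    rw [hper] at hz0 hz1
    have i3 := hA.intervalIntegrable_mul (k :=
        fun θ => -sin θ) continuous_sin.neg (a + π) (a + π + π)
    have i4 := hA.intervalIntegrable_mul (k := fun θ => cos θ) continuous_cos (a + π) (a + π + π)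
    have e : ∫ θ in (a + π)..(a + π + π),
          ρ θ * ((x θ 0 - x a 0) * cos θ + (x θ 1 - x a 1) * sin θ)
        = (∫ θ in (a + π)..(a + π + π),
            ρ θ * ((x θ 0 - x (a + π) 0) * cos θ + (x θ 1 - x (a + π) 1) * sin θ))
          + (x (a + π) 0 - x a 0) * (∫ θ in (a + π)..(a + π + π), ρ θ * cos θ)
          - (x (a + π) 1 - x a 1) * ∫ θ in (a + π)..(a + π + π), ρ θ * -sin θ := by
      rw [← intervalIntegral.integral_const_mul, ← intervalIntegral.integral_const_mul,
        ← intervalIntegral.integral_add (hi _ _ _) (i4.const_mul _),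
        ← intervalIntegral.integral_sub ((hi _ _ _).add (i4.const_mul _)) (i3.const_mul _)]
      exact intervalIntegral.integral_congr fun t _ => by ring
    rw [e, ← hz0, ← hz1]
    ring
  rw [e1, e1, ← e2]
  linarith

end IsSupportArc

namespace IsArcLength

variable {ρ s : ℝ → ℝ} (h : IsArcLength ρ s)
include h

theorem integral_mul_eq_of_sub_eq {a b : ℝ} (hab : a ≤ b) (he : s b - s a = b - a) {k : ℝ → ℝ}
    (hk : Continuous k) (hk1 : ∀ t, |k t| ≤ 1) : ∫ t in a..b, ρ t * k t = ∫ t in a..b, k t := by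
  have h1 : ∫ t in a..b, (1 - ρ t) = 0 := by
    rw [intervalIntegral.integral_sub (by simp) (h.intervalIntegrable a b), h.integral_eq]
    simp [he]
  have h2 : ‖∫ t in a..b, (k t - ρ t * k t)‖ ≤ ∫ t in a..b, (1 - ρ t) := by
    refine intervalIntegral.norm_integral_le_of_norm_le hab (.of_forall fun t _ => ?_)
      (intervalIntegrable_const.sub (h.intervalIntegrable a b))
    rw [← one_sub_mul, norm_mul, Real.norm_of_nonneg (by linarith [h.le_one t])]
    exact mul_le_of_le_one_right (by linarith [h.le_one t]) (hk1 t)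
  rw [h1, norm_le_zero_iff, intervalIntegral.integral_sub (hk.intervalIntegrable a b)
    (h.intervalIntegrable_mul hk a b), sub_eq_zero] at h2
  exact h2.symm

theorem sub_eq_of_sub_eq {a b t : ℝ} (hat : a ≤ t) (htb : t ≤ b) (he : s b - s a = b - a) :
    s t - s a = t - a := by
  linarith [h.sub_le hat, h.sub_le htb]

/-- If every half of the boundary is extremal, then the radius of curvature vanishes on an interval
whose length is the turning defect. -/
theorem exists_gap {D : ℝ} (hD0 : 0 ≤ D) (hDπ : D < π) (hD : ∀ a, s (a + π) - s a = π - D)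
    (heq : ∀ a, ∫ x in a..(a + π), ρ x * ∫ y in a..x, ρ y * sin (x - y)
      = (s (a + π) - s a) - sin (s (a + π) - s a)) :
    ∃ p, s (p + D) = s p := by
  rcases hD0.eq_or_lt with rfl | hD0
  · exact ⟨0, by simp⟩
  have hall : ∀ᵐ x, ∀ a : ℚ, x ∈ Ioc (a : ℝ) (a + π) → ρ x ≠ 0 →
      ∀ᵐ y, y ∈ Ioc (a : ℝ) x → ρ y ≠ 0 → (x - s x) - (y - s y) = 0 ∨ (x - s x) - (y - s y) = D :=
    ae_all_iff.2 fun a => h.ae_dichotomy_of_half_integral_eq (hD a) (heq a)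
  obtain ⟨β, hβ, hρβ⟩ : ∃ β, (∀ a : ℚ, β ∈ Ioc (a : ℝ) (a + π) → ρ β ≠ 0 → ∀ᵐ y,
      y ∈ Ioc (a : ℝ) β → ρ y ≠ 0 → (β - s β) - (y - s y) = 0 ∨ (β - s β) - (y - s y) = D) ∧
      ρ β ≠ 0 := by
    by_contra! hcon
    have h0 : ∀ᵐ t, ρ t = 0 := hall.mono hcon
    have h1 := h.integral_eq 0 (0 + π)
    rw [intervalIntegral.integral_congr_ae (g := fun _ => (0 : ℝ)) (h0.mono fun t ht _ => ht),
      intervalIntegral.integral_zero, hD] at h1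
    linarith
  have hae : ∀ᵐ y, y ∈ Ioc (β - π) β → ρ y ≠ 0 →
      (β - s β) - (y - s y) = 0 ∨ (β - s β) - (y - s y) = D := by
    have : ∀ᵐ y, ∀ a : ℚ, β ∈ Ioc (a : ℝ) (a + π) → y ∈ Ioc (a : ℝ) β → ρ y ≠ 0 →
        (β - s β) - (y - s y) = 0 ∨ (β - s β) - (y - s y) = D := by
      refine ae_all_iff.2 fun a => ?_
      by_cases ha : β ∈ Ioc (a : ℝ) (a + π)
      · exact (hβ a ha hρβ).mono fun y hy _ => hy
      · exact .of_forall fun y h1 => absurd h1 ha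
    filter_upwards [this] with y hy hyβ hρ
    obtain ⟨a, ha1, ha2⟩ := exists_rat_btwn hyβ.1
    exact hy a ⟨ha2.trans_le hyβ.2, by linarith⟩ ⟨ha2, hyβ.2⟩ hρ
  have hsc := h.continuous
  have hψc : Continuous fun t => t - s t := by fun_prop
  have hβπ : (β - π) - s (β - π) = β - s β - D := by
    have := hD (β - π)
    rw [sub_add_cancel] at this
    linarith
  have hlt : β - π < β := by linarith [pi_pos]
  obtain ⟨p, ⟨hp, hpe⟩, hpmax⟩ : ∃ p, IsGreatest {y ∈ Icc (β - π) β | y - s y = β - s β - D} p :=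
    (isCompact_Icc.inter_right (isClosed_singleton.preimage hψc)).exists_isGreatest
      ⟨β - π, ⟨le_rfl, hlt.le⟩, hβπ⟩
  obtain ⟨q, ⟨hq, hqe⟩, hqmin⟩ : ∃ q, IsLeast {y ∈ Icc (β - π) β | y - s y = β - s β} q :=
    (isCompact_Icc.inter_right (isClosed_singleton.preimage hψc)).exists_isLeast
      ⟨β, ⟨hlt.le, le_rfl⟩, rfl⟩
  have hpq : p < q := by
    by_contra! hcon
    linarith [h.sub_le hcon]
  have hs : s q - s p = 0 := by
    rw [← h.integral_eq, intervalIntegral.integral_congr_ae (g := fun _ => (0 : ℝ)),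
      intervalIntegral.integral_zero]
    filter_upwards [hae, Measure.ae_ne volume q] with t ht htq htpq
    rw [uIoc_of_le hpq.le] at htpq
    have htI : t ∈ Icc (β - π) β := ⟨hp.1.trans htpq.1.le, htpq.2.trans hq.2⟩
    by_contra hρ
    rcases ht ⟨hp.1.trans_lt htpq.1, htI.2⟩ hρ with h1 | h1
    · exact htq (le_antisymm htpq.2 (hqmin ⟨htI, by linarith⟩))
    · exact htpq.1.not_ge (hpmax ⟨htI, by linarith⟩)
  refine ⟨p, ?_⟩
  rw [show p + D = q by linarith]
  linarith

end IsArcLength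

/-- The lower bound for the sum of two segments is minimal for equal segments. -/
theorem two_arc_ge {u v : ℝ} (hu : 0 ≤ u) (hv : 0 ≤ v) (huv : u + v ≤ 2 * π) :
    (u + v) - 2 * sin ((u + v) / 2) ≤ (u - sin u) + (v - sin v) := by
  have e : sin u + sin v = 2 * sin ((u + v) / 2) * cos ((u - v) / 2) := by
    rw [sin_add_sin]
  have h1 : 0 ≤ sin ((u + v) / 2) := sin_nonneg_of_nonneg_of_le_pi (by linarith) (by linarith)
  nlinarith [cos_le_one ((u - v) / 2)]

theorem eq_of_two_arc_eq {u v : ℝ} (hu : 0 ≤ u) (hv : 0 ≤ v) (hu' : u ≤ π) (hv' : v ≤ π)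
    (he : (u - sin u) + (v - sin v) ≤ (u + v) - 2 * sin ((u + v) / 2)) : u = v := by
  have e : sin u + sin v = 2 * sin ((u + v) / 2) * cos ((u - v) / 2) := by
    rw [sin_add_sin]
  by_contra hne
  have h1 : 0 < sin ((u + v) / 2) := by
    refine sin_pos_of_pos_of_lt_pi ?_ ?_ <;> rcases lt_or_gt_of_ne hne with h | h <;> linarith
  have h2 : cos ((u - v) / 2) < 1 := by
    refine lt_of_le_of_ne (cos_le_one _) fun h => ?_
    rw [cos_eq_one_iff_of_lt_of_lt (by linarith [pi_pos]) (by linarith [pi_pos])] at h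
    exact hne (by linarith)
  nlinarith

namespace IsSupportArc

variable {K : Set Plane} {x : ℝ → Plane} {ρ s : ℝ → ℝ} (h : IsSupportArc K x ρ s)
include h

theorem sub_eq_arc_coord {a b t : ℝ} (hat : a ≤ t) (htb : t ≤ b) (he : s b - s a = b - a) :
    x t 0 - cos t = x a 0 - cos a ∧ x t 1 - sin t = x a 1 - sin a := by
  have hA := h.toIsArcLength
  have hst := hA.sub_eq_of_sub_eq hat htb he
  have h0 := h.sub_zero a t
  have h1 := h.sub_one a t
  rw [hA.integral_mul_eq_of_sub_eq hat hst (by fun_prop) (fun t => by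
    rw [abs_neg]; exact abs_sin_le_one t)] at h0
  rw [hA.integral_mul_eq_of_sub_eq hat hst (by fun_prop) abs_cos_le_one] at h1
  rw [intervalIntegral.integral_neg, integral_sin] at h0
  rw [integral_cos] at h1
  exact ⟨by linarith, by linarith⟩

theorem period_sub (a : ℝ) : s (a + 2 * π) - s a = s (2 * π) - s 0 := by
  have hA := h.toIsArcLength
  rw [← hA.integral_eq, ← hA.integral_eq, h.periodic_speed.intervalIntegral_add_eq a 0, zero_add]

/-- The reverse isoperimetric inequality in terms of arc length. -/
theorem area_ge (hKc : IsCompact K) (hK : Convex ℝ K) (a : ℝ) :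
    (s (a + 2 * π) - s a) - 2 * sin ((s (a + 2 * π) - s a) / 2) ≤ 2 * (volume K).toReal := by
  have hA := h.toIsArcLength
  have hπ := pi_pos
  have h1 := hA.half_integral_ge a
  have h2 := hA.half_integral_ge (a + π)
  have m1 := hA.monotone (show a ≤ a + π by linarith)
  have m2 := hA.monotone (show a + π ≤ a + π + π by linarith)
  have l1 := hA.sub_le (show a ≤ a + π by linarith)
  have l2 := hA.sub_le (show a + π ≤ a + π + π by linarith)
  have h3 := two_arc_ge (u := s (a + π) - s a) (v := s (a + π + π) - s (a + π)) (by linarith)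
    (by linarith) (by linarith)
  rw [h.two_mul_toReal_volume hKc hK a]
  rw [show a + 2 * π = a + π + π by ring]
  rw [show s (a + π) - s a + (s (a + π + π) - s (a + π)) = s (a + π + π) - s a by ring] at h3
  linarith

/-- In the equality case both halves of the boundary have the same length and are extremal. -/
theorem half_eq_of_area_le (hKc : IsCompact K) (hK : Convex ℝ K) (a : ℝ)
    (hle : 2 * (volume K).toReal
      ≤ (s (a + 2 * π) - s a) - 2 * sin ((s (a + 2 * π) - s a) / 2)) :
    s (a + π) - s a = (s (a + 2 * π) - s a) / 2 ∧
    ∫ x in a..(a + π), ρ x * ∫ y in a..x, ρ y * sin (x - y)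
      = (s (a + π) - s a) - sin (s (a + π) - s a) := by
  have hA := h.toIsArcLength
  have hπ := pi_pos
  have h1 := hA.half_integral_ge a
  have h2 := hA.half_integral_ge (a + π)
  have m1 := hA.monotone (show a ≤ a + π by linarith)
  have m2 := hA.monotone (show a + π ≤ a + π + π by linarith)
  have l1 := hA.sub_le (show a ≤ a + π by linarith)
  have l2 := hA.sub_le (show a + π ≤ a + π + π by linarith)
  have h3 := two_arc_ge (u := s (a + π) - s a) (v := s (a + π + π) - s (a + π)) (by linarith)
    (by linarith) (by linarith)
  have h4 := eq_of_two_arc_eq (u := s (a + π) - s a) (v := s (a + π + π) - s (a + π)) (by linarith)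
    (by linarith) (by linarith) (by linarith)
  rw [h.two_mul_toReal_volume hKc hK a, show a + 2 * π = a + π + π by ring] at hle
  rw [show a + 2 * π = a + π + π by ring]
  rw [show s (a + π) - s a + (s (a + π + π) - s (a + π)) = s (a + π + π) - s a by ring] at h3 h4
  exact ⟨by linarith [h4 (by linarith)], by linarith⟩

/-- A body whose boundary consists of two unit arcs and two corners is a lens. -/
theorem isLens_of_gap (hKc : IsCompact K) (hK : Convex ℝ K) (hKi : (interior K).Nonempty)
    {D p : ℝ} (hD0 : 0 ≤ D) (hDπ : D < π) (hD : ∀ a, s (a + π) - s a = π - D)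
    (hp : s (p + D) = s p) : IsLens 1 K := by
  have hS := h.toIsSupport
  have hπ := pi_pos
  have hp' : s (p + π + D) = s (p + π) := by
    have h1 := hD p
    have h2 := hD (p + D)
    rw [show p + D + π = p + π + D by ring] at h2
    linarith
  have harc : ∀ q, s (q + D) = s q → ∀ t ∈ Icc (q + D) (q + π),
      x t 0 - cos t = x (q + D) 0 - cos (q + D) ∧ x t 1 - sin t = x (q + D) 1 - sin (q + D) :=
    fun q hq t ht => h.sub_eq_arc_coord ht.1 ht.2 (by linarith [hD q])
  have hgap : ∀ q, s (q + D) = s q → ∀ t ∈ Icc q (q + D), x t = x q := by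
    intro q hq t ht
    refine hS.eq_of_mem_Icc ht.1 ht.2 (by linarith) (dist_le_zero.1 ?_).symm
    linarith [h.dist_le_arc (show q ≤ q + D by linarith)]
  set c : ℝ → Plane := fun q => !₂[x (q + D) 0 - cos (q + D), x (q + D) 1 - sin (q + D)] with hc
  have hball : ∀ q, s (q + D) = s q → ∀ t ∈ Icc (q + D) (q + π), ∀ z : Plane,
      z ∈ Metric.closedBall (c q) 1 ↔ (z 0 - x t 0) ^ 2 + (z 1 - x t 1) ^ 2
        ≤ 2 * ((x t 0 - z 0) * cos t + (x t 1 - z 1) * sin t) := by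
    intro q hq t ht z
    obtain ⟨e0, e1⟩ := harc q hq t ht
    rw [Metric.mem_closedBall, plane_dist_le_iff zero_le_one]
    simp only [hc, PiLp.toLp_apply, Matrix.cons_val_zero, Matrix.cons_val_one, ← e0, ← e1]
    have := cos_sq_add_sin_sq t
    constructor <;> intro hh <;> nlinarith
  have hsub : K ⊆ Metric.closedBall (c p) 1 ∩ Metric.closedBall (c (p + π)) 1 := fun z hz =>
    ⟨(hball p hp (p + D) ⟨le_rfl, by linarith⟩ z).2 (hS.le _ z hz),
      (hball (p + π) hp' (p + π + D) ⟨le_rfl, by linarith⟩ z).2 (hS.le _ z hz)⟩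
  refine ⟨c p, c (p + π), ?_, ?_⟩
  · obtain ⟨w, hw⟩ := hKi
    have := interior_mono hsub hw
    rw [interior_inter, interior_closedBall _ one_ne_zero,
        interior_closedBall _ one_ne_zero] at this
    have h1 := Metric.mem_ball.1 this.1
    have h2 := Metric.mem_ball.1 this.2
    rw [dist_comm] at h1
    linarith [dist_triangle (c p) w (c (p + π))]
  · rw [div_one]
    refine Subset.antisymm hsub fun z hz => ?_
    refine hS.mem_of_forall_normal_nonpos hKc.isClosed hK fun θ => ?_
    have hon : ∀ q, s (q + D) = s q → z ∈ Metric.closedBall (c q) 1 → ∀ t ∈ Icc (q + D) (q + π),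
        (z 0 - x t 0) * cos t + (z 1 - x t 1) * sin t ≤ 0 := by
      intro q hq hzq t ht
      have := (hball q hq t ht z).1 hzq
      nlinarith [sq_nonneg (z 0 - x t 0), sq_nonneg (z 1 - x t 1)]
    have hbetween : ∀ q, s (q + D) = s q →
        (z 0 - x q 0) * cos q + (z 1 - x q 1) * sin q ≤ 0 →
        (z 0 - x (q + D) 0) * cos (q + D) + (z 1 - x (q + D) 1) * sin (q + D) ≤ 0 →
        ∀ t ∈ Icc q (q + D), (z 0 - x t 0) * cos t + (z 1 - x t 1) * sin t ≤ 0 := by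
      intro q hq h1 h2 t ht
      rw [hgap q hq (q + D) ⟨by linarith, le_rfl⟩] at h2
      rw [hgap q hq t ht]
      exact inner_normal_nonpos_of_between ht.1 ht.2 (by linarith) h1 h2
    have hper : ∀ t, (z 0 - x (t + 2 * π) 0) * cos (t + 2 * π)
        + (z 1 - x (t + 2 * π) 1) * sin (t + 2 * π)
        = (z 0 - x t 0) * cos t + (z 1 - x t 1) * sin t := fun t => by
      rw [hS.periodic, cos_add_two_pi, sin_add_two_pi]
    have hp0 : (z 0 - x p 0) * cos p + (z 1 - x p 1) * sin p ≤ 0 := by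
      rw [← hper, show p + 2 * π = p + π + π by ring]
      exact hon (p + π) hp' hz.2 _ ⟨by linarith, le_rfl⟩
    have hwindow : ∀ t ∈ Ico p (p + 2 * π),
        (z 0 - x t 0) * cos t + (z 1 - x t 1) * sin t ≤ 0 := by
      intro t ht
      rcases le_total t (p + π) with h1 | h1
      · rcases le_total t (p + D) with h2 | h2
        · exact hbetween p hp hp0 (hon p hp hz.1 _ ⟨le_rfl, by linarith⟩) t ⟨ht.1, h2⟩
        · exact hon p hp hz.1 t ⟨h2, h1⟩
      · rcases le_total t (p + π + D) with h2 | h2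
        · exact hbetween _ hp' (hon p hp hz.1 _ ⟨by linarith, le_rfl⟩)
            (hon _ hp' hz.2 _ ⟨le_rfl, by linarith⟩) t ⟨h1, h2⟩
        · exact hon _ hp' hz.2 t ⟨h2, by linarith [ht.2]⟩
    have hperiodic : Periodic (fun t => (z 0 - x t 0) * cos t + (z 1 - x t 1) * sin t) (2 * π) :=
        hper
    obtain ⟨t, ht, e⟩ := hperiodic.exists_mem_Ico (by positivity) θ p
    simp only at e
    rw [e]
    exact hwindow t ht

theorem isLens_of_area_le (hKc : IsCompact K) (hK : Convex ℝ K) (hKi : (interior K).Nonempty)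
    (hle : 2 * (volume K).toReal
      ≤ (s (2 * π) - s 0) - 2 * sin ((s (2 * π) - s 0) / 2)) : IsLens 1 K := by
  have hA := h.toIsArcLength
  have hπ := pi_pos
  set D := π - (s (2 * π) - s 0) / 2 with hDdef
  have hhalf := fun a => h.half_eq_of_area_le hKc hK a (by rwa [h.period_sub a])
  have hD : ∀ a, s (a + π) - s a = π - D := by
    intro a
    rw [(hhalf a).1, h.period_sub]
    ring
  have hD0 : 0 ≤ D := by linarith [hA.sub_le (show 0 ≤ 2 * π by linarith)]
  have hDπ : D < π := by
    have h1 := dist_pos.2 (h.toIsSupport.ne_add_pi hKi 0)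
    linarith [hD 0, h.dist_le_arc (show 0 ≤ 0 + π by linarith)]
  obtain ⟨p, hp⟩ := hA.exists_gap hD0 hDπ hD fun a => (hhalf a).2
  exact h.isLens_of_gap hKc hK hKi hD0 hDπ hD hp

end IsSupportArc

namespace IsSupportArc

variable {K : Set Plane} {x : ℝ → Plane} {ρ s : ℝ → ℝ} (h : IsSupportArc K x ρ s)
include h

theorem ae_speed_eq {a b : ℝ} (c : Plane) (r : ℝ)
    (hx : ∀ t ∈ Ioo a b, x t 0 = c 0 + r * cos t ∧ x t 1 = c 1 + r * sin t) :
    ∀ᵐ t, t ∈ Ioc a b → ρ t = r := by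
  filter_upwards [h.hasDerivAt_zero, h.hasDerivAt_one, Measure.ae_ne volume b] with t h0 h1 htb ht
  have htI : Ioo a b ∈ nhds t := Ioo_mem_nhds ht.1 (lt_of_le_of_ne ht.2 htb)
  have e0 : HasDerivAt (fun t => x t 0) (r * -sin t) t :=
    (((hasDerivAt_cos t).const_mul r).const_add (c 0)).congr_of_eventuallyEq
      (Filter.eventuallyEq_of_mem htI fun t ht => (hx t ht).1)
  have e1 : HasDerivAt (fun t => x t 1) (r * cos t) t :=
    (((hasDerivAt_sin t).const_mul r).const_add (c 1)).congr_of_eventuallyEq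
      (Filter.eventuallyEq_of_mem htI fun t ht => (hx t ht).2)
  have u0 := h0.unique e0
  have u1 := h1.unique e1
  have := cos_sq_add_sin_sq t
  linear_combination (-sin t) * u0 + cos t * u1 + (r - ρ t) * this

theorem integral_speed_mul_eq {a b : ℝ} (hab : a ≤ b) (c : Plane) (r : ℝ)
    (hx : ∀ t ∈ Icc a b, x t 0 = c 0 + r * cos t ∧ x t 1 = c 1 + r * sin t) (k : ℝ → ℝ) :
    ∫ t in a..b, ρ t * k t = r * ∫ t in a..b, k t := by
  rw [← intervalIntegral.integral_const_mul]
  refine intervalIntegral.integral_congr_ae ?_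
  filter_upwards [h.ae_speed_eq c r fun t ht => hx t (Ioo_subset_Icc_self ht)] with t ht htI
  rw [uIoc_of_le hab] at htI
  rw [ht htI]

omit h in
/-- Support points of a lens in terms of the half-opening angle. -/
theorem _root_.IsSupport.eq_of_lens {c₁ c₂ : Plane} (h : IsSupport K x)
    (hK : K = Metric.closedBall c₁ 1 ∩ Metric.closedBall c₂ 1) {a α : ℝ} (ha : 0 ≤ a)
    (e0 : c₂ 0 = c₁ 0 + 2 * a * cos α) (e1 : c₂ 1 = c₁ 1 + 2 * a * sin α) {θ : ℝ}
    (hθ : a ≤ cos (θ - α)) : x θ 0 = c₁ 0 + cos θ ∧ x θ 1 = c₁ 1 + sin θ := by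
  have hy : (!₂[c₁ 0 + cos θ, c₁ 1 + sin θ] : Plane) ∈ K := by
    rw [hK]
    constructor
    · rw [Metric.mem_closedBall, plane_dist_le_iff zero_le_one]
      simp
    · rw [Metric.mem_closedBall, plane_dist_le_iff zero_le_one]
      simp only [Matrix.cons_val_zero, Matrix.cons_val_one, e0, e1]
      rw [cos_sub] at hθ
      nlinarith [cos_sq_add_sin_sq θ, cos_sq_add_sin_sq α, mul_le_mul_of_nonneg_left hθ ha]
  have hx := h.mem θ
  rw [hK] at hx
  have hx1 := hx.1
  rw [Metric.mem_closedBall, plane_dist_le_iff zero_le_one] at hx1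
  have := h.eq_of_le (θ := θ) hy (by
    simp only [Matrix.cons_val_zero, Matrix.cons_val_one]
    nlinarith [sq_nonneg (x θ 0 - c₁ 0 - cos θ), sq_nonneg (x θ 1 - c₁ 1 - sin θ),
      cos_sq_add_sin_sq θ])
  rw [← this]
  simp

theorem area_eq_of_isLens (hKc : IsCompact K) (hK : Convex ℝ K) (hL : IsLens 1 K) :
    2 * (volume K).toReal = (s (2 * π) - s 0) - 2 * sin ((s (2 * π) - s 0) / 2) := by
  have hS := h.toIsSupport
  have hA := h.toIsArcLength
  have hπ := pi_pos
  obtain ⟨c₁, c₂, hdist, hKL⟩ := hL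
  rw [div_one] at hdist hKL
  set z : ℂ := ⟨c₂ 0 - c₁ 0, c₂ 1 - c₁ 1⟩ with hz
  set α := z.arg with hα
  set a := ‖z‖ / 2 with ha
  have ha0 : 0 ≤ a := by positivity
  have e0 : c₂ 0 = c₁ 0 + 2 * a * cos α := by
    have : ‖z‖ * cos z.arg = c₂ 0 - c₁ 0 := Complex.norm_mul_cos_arg z
    rw [ha, hα]; linarith
  have e1 : c₂ 1 = c₁ 1 + 2 * a * sin α := by
    have : ‖z‖ * sin z.arg = c₂ 1 - c₁ 1 := Complex.norm_mul_sin_arg z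
    rw [ha, hα]; linarith
  have ha1 : a < 1 := by
    have := (plane_dist_lt_iff zero_le_two).1 hdist
    rw [e0, e1] at this
    have e : 4 * a ^ 2 * (cos α ^ 2 + sin α ^ 2) < 2 ^ 2 := by linarith
    rw [cos_sq_add_sin_sq] at e
    nlinarith
  set b := arccos a with hb
  have hcb : cos b = a := cos_arccos (by linarith) ha1.le
  have hb0 : 0 < b := arccos_pos.2 ha1
  have hb2 : b ≤ π / 2 := arccos_le_pi_div_two.2 ha0
  have hcos : ∀ t, |t| ≤ b → a ≤ cos t := by
    intro t ht
    rw [← cos_abs, ← hcb]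
    exact cos_le_cos_of_nonneg_of_le_pi (abs_nonneg t) (by linarith) ht
  have harc1 : ∀ t ∈ Icc (α - b) (α + b), x t 0 = c₁ 0 + cos t ∧ x t 1 = c₁ 1 + sin t :=
    fun t ht => hS.eq_of_lens hKL ha0 e0 e1
      (hcos _ (abs_le.2 ⟨by linarith [ht.1], by linarith [ht.2]⟩))
  have harc2 : ∀ t ∈ Icc (α + π - b) (α + π + b), x t 0 = c₂ 0 + cos t ∧ x t 1 = c₂ 1 + sin t := by
    intro t ht
    refine hS.eq_of_lens (by rw [hKL, inter_comm]) ha0 (α := α + π) ?_ ?_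
      (hcos _ (abs_le.2 ⟨by linarith [ht.1], by linarith [ht.2]⟩))
    · rw [cos_add_pi, e0]; ring
    · rw [sin_add_pi, e1]; ring
  have hcorner1 : x (α + b) = x (α + π - b) := by
    have h1 := harc1 (α + b) ⟨by linarith, le_rfl⟩
    have h2 := harc2 (α + π - b) ⟨le_rfl, by linarith⟩
    rw [show α + π - b = α - b + π by ring, cos_add_pi, sin_add_pi, cos_sub, sin_sub, hcb, e0, e1]
      at h2
    rw [cos_add, sin_add, hcb] at h1
    ext i
    fin_cases i
    · simp only [Fin.zero_eta, h1.1]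
      rw [show α + π - b = α - b + π by ring, h2.1]; ring
    · simp only [Fin.mk_one, h1.2]
      rw [show α + π - b = α - b + π by ring, h2.2]; ring
  have hcorner2 : x (α + π + b) = x (α + 2 * π - b) := by
    have h1 := harc1 (α - b) ⟨le_rfl, by linarith⟩
    have h2 := harc2 (α + π + b) ⟨by linarith, le_rfl⟩
    rw [show α + π + b = α + b + π by ring, cos_add_pi, sin_add_pi, cos_add, sin_add, hcb, e0, e1]
      at h2
    rw [cos_sub, sin_sub, hcb] at h1
    rw [show α + 2 * π - b = α - b + 2 * π by ring, hS.periodic,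
      show α + π + b = α + b + π by ring]
    ext i
    fin_cases i
    · simp only [Fin.zero_eta, h1.1, h2.1]; ring
    · simp only [Fin.mk_one, h1.2, h2.2]; ring
  have hgap1 : ∀ t ∈ Icc (α + b) (α + π - b), x t = x (α + b) := fun t ht =>
    hS.eq_of_mem_Icc ht.1 ht.2 (by linarith) hcorner1
  have hgap2 : ∀ t ∈ Icc (α + π + b) (α + 2 * π - b), x t = x (α + π + b) := fun t ht =>
    hS.eq_of_mem_Icc ht.1 ht.2 (by linarith) hcorner2
  have hsplit : ∀ k : ℝ → ℝ, Continuous k →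
      ∫ t in (α - b)..(α - b + 2 * π), ρ t * k t
        = (∫ t in (α - b)..(α + b), k t) + ∫ t in (α + π - b)..(α + π + b), k t := by
    intro k hk
    have hi := hA.intervalIntegrable_mul hk
    rw [← intervalIntegral.integral_add_adjacent_intervals (hi (α - b) (α + b)) (hi _ _),
      ← intervalIntegral.integral_add_adjacent_intervals (hi (α + b) (α + π - b)) (hi _ _),
      ← intervalIntegral.integral_add_adjacent_intervals (hi (α + π - b) (α + π + b)) (hi _ _),
      h.integral_speed_mul_eq (by linarith) c₁ 1 (fun t ht => by simpa using harc1 t ht),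
      h.integral_speed_mul_eq (by linarith) (x (α + b)) 0 (fun t ht => by simp [hgap1 t ht]),
      h.integral_speed_mul_eq (by linarith) c₂ 1 (fun t ht => by simpa using harc2 t ht),
      h.integral_speed_mul_eq (by linarith) (x (α + π + b)) 0
        (fun t ht => by
          rw [show α - b + 2 * π = α + 2 * π - b by ring] at ht
          simp [hgap2 t ht])]
    ring
  have hlen : s (2 * π) - s 0 = 4 * b := by
    rw [← h.period_sub (α - b), ← hA.integral_eq]
    have := hsplit (fun _ => 1) continuous_const
    simp only [mul_one, integral_one] at this
    rw [this]
    ring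
  set o : Plane := !₂[c₁ 0 + a * cos α, c₁ 1 + a * sin α] with ho
  have ho0 : o 0 = c₁ 0 + a * cos α := by simp [ho]
  have ho1 : o 1 = c₁ 1 + a * sin α := by simp [ho]
  have hI1 : ∫ t in (α - b)..(α + b), ((x t 0 - o 0) * cos t + (x t 1 - o 1) * sin t)
      = 2 * b - 2 * a * sin b := by
    have : ∫ t in (α - b)..(α + b), ((x t 0 - o 0) * cos t + (x t 1 - o 1) * sin t)
        = ∫ t in (α - b)..(α + b), (1 - a * cos (t - α)) := by
      refine intervalIntegral.integral_congr fun t ht => ?_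
      rw [uIcc_of_le (by linarith)] at ht
      simp only [(harc1 t ht).1, (harc1 t ht).2, ho0, ho1, cos_sub]
      linear_combination cos_sq_add_sin_sq t
    rw [this, intervalIntegral.integral_sub (by simp)
      (Continuous.intervalIntegrable (by fun_prop) _ _), intervalIntegral.integral_const_mul,
      intervalIntegral.integral_comp_sub_right (fun t => cos t), integral_cos]
    simp
    ring
  have hI2 : ∫ t in (α + π - b)..(α + π + b), ((x t 0 - o 0) * cos t + (x t 1 - o 1) * sin t)
      = 2 * b - 2 * a * sin b := by
    have : ∫ t in (α + π - b)..(α + π + b), ((x t 0 - o 0) * cos t + (x t 1 - o 1) * sin t)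
        = ∫ t in (α + π - b)..(α + π + b), (1 - a * cos (t - (α + π))) := by
      refine intervalIntegral.integral_congr fun t ht => ?_
      rw [uIcc_of_le (by linarith)] at ht
      simp only [(harc2 t ht).1, (harc2 t ht).2, ho0, ho1, e0, e1, cos_sub, cos_add_pi, sin_add_pi]
      linear_combination cos_sq_add_sin_sq t
    rw [this, intervalIntegral.integral_sub (by simp)
      (Continuous.intervalIntegrable (by fun_prop) _ _), intervalIntegral.integral_const_mul,
      intervalIntegral.integral_comp_sub_right (fun t => cos t), integral_cos]
    simp
    ring
  have hc0 := hS.continuous_coord 0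
  have hc1 := hS.continuous_coord 1
  rw [h.toReal_volume_eq hKc hK (α - b) o,
    hsplit (fun t => (x t 0 - o 0) * cos t + (x t 1 - o 1) * sin t)
      (((hc0.sub continuous_const).mul continuous_cos).add
        ((hc1.sub continuous_const).mul continuous_sin)), hI1, hI2, hlen,
    show 4 * b / 2 = 2 * b by ring, sin_two_mul, hcb]
  ring

end IsSupportArc

open Pointwise in
theorem frontier_smul₀ {E : Type*} [NormedAddCommGroup E] [NormedSpace ℝ E] {c : ℝ} (hc : c ≠ 0)
    (K : Set E) : frontier (c • K) = c • frontier K :=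
  ((Homeomorph.smulOfNeZero c hc).image_frontier K).symm

open Pointwise in
theorem IsLambdaConvex.smul {n : ℕ} {lam c : ℝ} (hc : 0 < c)
    {K : Set (EuclideanSpace ℝ (Fin n))} (h : IsLambdaConvex lam K) :
    IsLambdaConvex (lam / c) (c • K) := by
  intro p hp
  rw [frontier_smul₀ hc.ne'] at hp
  obtain ⟨q, hq, rfl⟩ := hp
  obtain ⟨U, hU, z, hz, hUz⟩ := h q hq
  refine ⟨c • U, (smul_mem_nhds_smul_iff₀ hc.ne').2 hU, c • z, ?_, ?_⟩
  · change dist (c • q) (c • z) = _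
    rw [dist_smul₀, hz, Real.norm_of_nonneg hc.le]
    field_simp
  · rw [frontier_smul₀ hc.ne', ← smul_set_inter₀ hc.ne']
    refine (smul_set_mono hUz).trans ?_
    rw [smul_closedBall' hc.ne', Real.norm_of_nonneg hc.le]
    exact Metric.closedBall_subset_closedBall (le_of_eq (by field_simp))

open Pointwise in
theorem IsLens.smul {n : ℕ} {lam c : ℝ} (hc : 0 < c)
    {K : Set (EuclideanSpace ℝ (Fin n))} (h : IsLens lam K) : IsLens (lam / c) (c • K) := by
  obtain ⟨c₁, c₂, hd, rfl⟩ := h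
  refine ⟨c • c₁, c • c₂, ?_, ?_⟩
  · rw [dist_smul₀, Real.norm_of_nonneg hc.le, div_div_eq_mul_div, mul_comm, mul_div_right_comm]
    exact mul_lt_mul_of_pos_right hd hc
  · rw [smul_set_inter₀ hc.ne', smul_closedBall' hc.ne', smul_closedBall' hc.ne',
      Real.norm_of_nonneg hc.le]
    congr 2 <;> field_simp

open Pointwise in
theorem isLens_one_smul_iff {n : ℕ} {lam : ℝ} (hlam : 0 < lam)
    {K : Set (EuclideanSpace ℝ (Fin n))} : IsLens 1 (lam • K) ↔ IsLens lam K := by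
  constructor
  · intro h
    have := h.smul (inv_pos.2 hlam)
    rwa [inv_smul_smul₀ hlam.ne', one_div, inv_inv] at this
  · intro h
    have := h.smul hlam
    rwa [div_self hlam.ne'] at this

theorem area_unit_convex {K : Set Plane} (hKc : IsCompact K) (hK : Convex ℝ K)
    (hKi : (interior K).Nonempty) (hL : IsLambdaConvex 1 K) :
    (μH[1] (frontier K)).toReal - 2 * sin ((μH[1] (frontier K)).toReal / 2)
      ≤ 2 * (volume K).toReal ∧
    (2 * (volume K).toReal
      = (μH[1] (frontier K)).toReal - 2 * sin ((μH[1] (frontier K)).toReal / 2) ↔ IsLens 1 K) := by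
  obtain ⟨x, hx⟩ := exists_isSupport hKc hK hKi hL
  obtain ⟨ρ, s, h⟩ := hx.exists_isSupportArc
  have hlen := h.toReal_hausdorffMeasure_frontier hKc.isClosed hK hKi 0
  have harea := h.area_ge hKc hK 0
  rw [zero_add] at hlen harea
  rw [hlen]
  exact ⟨harea, fun he => h.isLens_of_area_le hKc hK hKi he.le, h.area_eq_of_isLens hKc hK⟩

open Pointwise in
theorem area_lambda_convex {lam : ℝ} (hlam : 0 < lam) {K : Set Plane} (hKc : IsCompact K)
    (hK : Convex ℝ K) (hKi : (interior K).Nonempty) (hL : IsLambdaConvex lam K) :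
    lam * (μH[1] (frontier K)).toReal - 2 * sin (lam * (μH[1] (frontier K)).toReal / 2)
      ≤ 2 * (lam ^ 2 * (volume K).toReal) ∧
    (2 * (lam ^ 2 * (volume K).toReal)
      = lam * (μH[1] (frontier K)).toReal - 2 * sin (lam * (μH[1] (frontier K)).toReal / 2)
      ↔ IsLens lam K) := by
  have hlam0 := hlam.ne'
  have hL' := hL.smul hlam
  rw [div_self hlam0] at hL'
  have hi : (interior (lam • K)).Nonempty := by
    rw [interior_smul₀ hlam0]
    exact hKi.smul_set
  have hlen : (μH[1] (frontier (lam • K))).toReal = lam * (μH[1] (frontier K)).toReal := by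
    rw [frontier_smul₀ hlam0, Measure.hausdorffMeasure_smul₀ zero_le_one hlam0]
    simp [abs_of_pos hlam]
  have hvol : (volume (lam • K)).toReal = lam ^ 2 * (volume K).toReal := by
    rw [Measure.addHaar_smul]
    simp [sq_nonneg]
  have h := area_unit_convex (hKc.smul lam) (hK.smul lam) hi hL'
  rwa [isLens_one_smul_iff hlam, hlen, hvol] at h

end

theorem stmt_10 (lam : ℝ) (hlam : 0 < lam)
    (K : Set (EuclideanSpace ℝ (Fin 2)))
    (hKc : IsCompact K) (hKconv : Convex ℝ K) (hKint : (interior K).Nonempty)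
    (hK : IsLambdaConvex lam K) :
    (μH[1] (frontier K)).toReal / (2 * lam)
        - (1 / lam ^ 2) * Real.sin (lam * (μH[1] (frontier K)).toReal / 2)
      ≤ (volume K).toReal ∧
    ((volume K).toReal = (μH[1] (frontier K)).toReal / (2 * lam)
        - (1 / lam ^ 2) * Real.sin (lam * (μH[1] (frontier K)).toReal / 2)
      ↔ IsLens lam K) := by
  obtain ⟨h1, h2⟩ := area_lambda_convex hlam hKc hKconv hKint hK
  set L := (μH[1] (frontier K)).toReal
  have e : L / (2 * lam) - (1 / lam ^ 2) * Real.sin (lam * L / 2)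
      = (lam * L - 2 * sin (lam * L / 2)) / (2 * lam ^ 2) := by
    field_simp
  have hpos : 0 < 2 * lam ^ 2 := by positivity
  rw [e, div_le_iff₀ hpos, ← h2, eq_div_iff hpos.ne']
  refine ⟨by linarith, ?_⟩
  rw [mul_comm (volume K).toReal, mul_assoc]
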